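/- Let q = p^h with p prime and h ≥ 1. There exist real constants A > 0 and ε > 0 such that for every function k : ℕ → ℕ satisfying k(n) ≤ n for all n and lim_{n→∞} ( n²/4 − ε·n + A·√n − k(n)·(n − k(n)) ) = −∞ (condition (⋆)), each of the three ratios N^S_{k(2m),2m}/N^S_{2m}, N^M_{k(2m),2m}/N^M_{2m}, and N^Γ_{k(2m),2m}/N^Γ_{2m} is asymptotically equivalent, as m → ∞, to q^{−(m − k(2m))²} / θ₃(q^{−1}). -/

import Mathlib

open Filter Matrix
open scoped Topology

/-- The `q`-binomial coefficient `binom(n,k)_q = ∏_{j=0}^{k-1} (q^{n-j}-1)/(q^{k-j}-1)`. -/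
noncomputable def qBinom (q n k : ℕ) : ℝ :=
  ∏ j ∈ Finset.range k, ((q : ℝ) ^ (n - j) - 1) / ((q : ℝ) ^ (k - j) - 1)

/-- `S(n) = ∑_{k=0}^n binom(n,k)_q`. -/
noncomputable def Sq (q n : ℕ) : ℝ := ∑ k ∈ Finset.range (n + 1), qBinom q n k

/-- `K_q = ∏_{j=1}^∞ (1 - q^{-j})`. -/
noncomputable def Kq (q : ℕ) : ℝ := ∏' j : ℕ, (1 - ((q : ℝ))⁻¹ ^ (j + 1))

/-- `K_q(k) = ∏_{j=1}^{k} (1 - q^{-j})`. -/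
noncomputable def KqTrunc (q k : ℕ) : ℝ := ∏ j ∈ Finset.range k, (1 - ((q : ℝ))⁻¹ ^ (j + 1))

/-- Jacobi theta constant `θ₂(w) = ∑_{k∈ℤ} w^{(k+1/2)²}`. -/
noncomputable def theta2 (w : ℝ) : ℝ := ∑' k : ℤ, w ^ (((k : ℝ) + 1/2) ^ 2)

/-- Jacobi theta constant `θ₃(w) = ∑_{k∈ℤ} w^{k²}`. -/
noncomputable def theta3 (w : ℝ) : ℝ := ∑' k : ℤ, w ^ ((k : ℝ) ^ 2)

/-- Condition (⋆): `n²/4 − ε·n + A·√n − k(n)(n−k(n)) → −∞`. -/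
def StarCond (A ε : ℝ) (k : ℕ → ℕ) : Prop :=
  Tendsto (fun n : ℕ =>
    (n : ℝ) ^ 2 / 4 - ε * n + A * Real.sqrt n - (k n : ℝ) * ((n : ℝ) - (k n : ℝ)))
    atTop atBot

/-- The set of permutation matrices inside `GL n F`. -/
def permSet (F : Type) [Field F] (n : ℕ) : Set (GL (Fin n) F) :=
  {M | ∃ σ : Equiv.Perm (Fin n), (M : Matrix (Fin n) (Fin n) F) = σ.permMatrix F}

/-- The set of invertible diagonal matrices inside `GL n F`. -/
def diagSet (F : Type) [Field F] (n : ℕ) : Set (GL (Fin n) F) :=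
  {M | ∃ d : Fin n → F, (M : Matrix (Fin n) (Fin n) F) = Matrix.diagonal d}

/-- The permutation group: subgroup of `GL n F` formed by the permutation matrices. -/
def PermGroup (F : Type) [Field F] (n : ℕ) : Subgroup (GL (Fin n) F) :=
  Subgroup.closure (permSet F n)

/-- The monomial group: subgroup of `GL n F` generated by permutation and diagonal matrices. -/
def MonomialGroup (F : Type) [Field F] (n : ℕ) : Subgroup (GL (Fin n) F) :=
  Subgroup.closure (permSet F n ∪ diagSet F n)

/-- Number of orbits of a subgroup `G ≤ GL n F` acting on the Grassmannian of
`k`-dimensional subspaces of `F^n` (by taking images of subspaces). -/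
noncomputable def numClassesDim {n : ℕ} (F : Type) [Field F]
    (G : Subgroup (GL (Fin n) F)) (k : ℕ) : ℕ :=
  Nat.card (Quot (fun V W : {V : Submodule F (Fin n → F) // Module.finrank F V = k} =>
    ∃ M ∈ G, Submodule.map (Matrix.toLin' (M : Matrix (Fin n) (Fin n) F)) V.1 = W.1))

/-- Number of orbits of a subgroup `G ≤ GL n F` acting on the set of all subspaces of `F^n`. -/
noncomputable def numClasses {n : ℕ} (F : Type) [Field F]
    (G : Subgroup (GL (Fin n) F)) : ℕ :=
  Nat.card (Quot (fun V W : Submodule F (Fin n → F) =>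
    ∃ M ∈ G, Submodule.map (Matrix.toLin' (M : Matrix (Fin n) (Fin n) F)) V = W))

/-- Semilinear orbit relation: `W` is the image of `V` under the semilinear transformation
given by applying the field automorphism `σ` componentwise followed by a monomial matrix. -/
def semiRel (F : Type) [Field F] (n : ℕ) (V W : Submodule F (Fin n → F)) : Prop :=
  ∃ σ : F ≃+* F, ∃ M ∈ MonomialGroup F n,
    (W : Set (Fin n → F)) =
      (fun x => Matrix.mulVec (M : Matrix (Fin n) (Fin n) F) (fun i => σ (x i))) '' (V : Set (Fin n → F))

/-- Number of semilinear equivalence classes of `k`-dimensional subspaces of `F^n`. -/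
noncomputable def numClassesDimSemi (F : Type) [Field F] (n k : ℕ) : ℕ :=
  Nat.card (Quot (fun V W : {V : Submodule F (Fin n → F) // Module.finrank F V = k} =>
    semiRel F n V.1 W.1))

/-- Number of semilinear equivalence classes of subspaces of `F^n`. -/
noncomputable def numClassesSemi (F : Type) [Field F] (n : ℕ) : ℕ :=
  Nat.card (Quot (fun V W : Submodule F (Fin n → F) => semiRel F n V W))

section GrassmannianCount

variable {F : Type} [Field F] [Fintype F] {V : Type} [AddCommGroup V] [Module F V] [Finite V]

/-- Linearly independent `k`-tuples of `V` correspond to pairs of a `k`-dimensional subspace and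
a linearly independent `k`-tuple in it. -/
noncomputable def linearIndependentEquivSigma (k : ℕ) :
    {s : Fin k → V // LinearIndependent F s} ≃
      Σ W : {W : Submodule F V // Module.finrank F W = k},
        {s : Fin k → W.1 // LinearIndependent F s} where
  toFun s := ⟨⟨Submodule.span F (Set.range s.1), by simp [finrank_span_eq_card s.2]⟩,
    ⟨fun i => ⟨s.1 i, Submodule.subset_span ⟨i, rfl⟩⟩, by
      refine LinearIndependent.of_comp (Submodule.subtype _) ?_
      exact s.2⟩⟩
  invFun t := ⟨fun i => (t.2.1 i : V), t.2.2.map' (Submodule.subtype _) (Submodule.ker_subtype _)⟩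
  left_inv s := rfl
  right_inv := by
    rintro ⟨⟨W, hW⟩, ⟨s, hs⟩⟩
    have hspan : Submodule.span F (Set.range fun i => (s i : V)) = W := by
      have : FiniteDimensional F W := inferInstance
      refine Submodule.eq_of_le_of_finrank_eq ?_ ?_
      · rw [Submodule.span_le]; rintro _ ⟨i, rfl⟩; exact (s i).2
      · have := finrank_span_eq_card (hs.map' (Submodule.subtype _) (Submodule.ker_subtype _))
        rw [Fintype.card_fin] at this
        exact this.trans hW.symm
    have key : ∀ (W' : Submodule F V) (h : W' = W) (h1 : Module.finrank F W' = k)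
        (t : Fin k → W') (ht : LinearIndependent F t), (∀ i, (t i : V) = s i) →
        (⟨⟨W', h1⟩, ⟨t, ht⟩⟩ : Σ W : {W : Submodule F V // Module.finrank F W = k},
        {s : Fin k → W.1 // LinearIndependent F s}) = ⟨⟨W, hW⟩, ⟨s, hs⟩⟩ := by
      rintro W' rfl h1 t ht h
      obtain rfl : t = s := by
        funext i; exact Subtype.ext (h i)
      rfl
    exact key _ hspan _ _ _ fun i => rfl

theorem card_subspaces_mul_prod {k : ℕ} (hk : k ≤ Module.finrank F V) :
    Nat.card {W : Submodule F V // Module.finrank F W = k} *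
      ∏ i : Fin k, (Fintype.card F ^ k - Fintype.card F ^ i.val) =
    ∏ i : Fin k, (Fintype.card F ^ Module.finrank F V - Fintype.card F ^ i.val) := by
  classical
  rw [← card_linearIndependent hk, Nat.card_congr (linearIndependentEquivSigma k)]
  have : Fintype {W : Submodule F V // Module.finrank F W = k} := Fintype.ofFinite _
  rw [Nat.card_sigma, Finset.sum_congr rfl (g := fun _ =>
    ∏ i : Fin k, (Fintype.card F ^ k - Fintype.card F ^ i.val))]
  · simp [Nat.card_eq_fintype_card]
  · intro W _
    rw [card_linearIndependent W.2.ge, W.2]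

end GrassmannianCount

section KqTruncLemmas

theorem KqTrunc_succ (q n : ℕ) :
    KqTrunc q (n + 1) = KqTrunc q n * (1 - ((q : ℝ))⁻¹ ^ (n + 1)) := by
  simp [KqTrunc, Finset.prod_range_succ]

theorem inv_pow_le_two_inv_pow {q : ℕ} (hq : 2 ≤ q) (n : ℕ) :
    ((q : ℝ))⁻¹ ^ n ≤ (2 : ℝ)⁻¹ ^ n := by
  have : (2 : ℝ) ≤ q := by exact_mod_cast hq
  gcongr

theorem KqTrunc_ge_aux {q : ℕ} (hq : 2 ≤ q) (n : ℕ) :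
    1 / 4 + (2 : ℝ)⁻¹ ^ (n + 2) ≤ KqTrunc q (n + 1) := by
  induction n with
  | zero =>
    have := inv_pow_le_two_inv_pow hq 1
    simp [KqTrunc] at *
    norm_num at *
    linarith
  | succ n ih =>
    rw [KqTrunc_succ]
    have h1 := inv_pow_le_two_inv_pow hq (n + 1 + 1)
    have h2 : (2 : ℝ)⁻¹ ^ (n + 2) ≤ 1 / 4 := by
      rw [pow_add]
      have : (2 : ℝ)⁻¹ ^ n ≤ 1 := pow_le_one₀ (by norm_num) (by norm_num)
      norm_num at *
      linarith
    have h3 : (0 : ℝ) < (2 : ℝ)⁻¹ ^ (n + 2) := by positivity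
    have h4 : (2 : ℝ)⁻¹ ^ (n + 1 + 2) = 1 / 2 * (2 : ℝ)⁻¹ ^ (n + 2) := by
      rw [pow_succ' _ (n + 2)]; norm_num
    rw [h4]
    calc _ ≤ (1 / 4 + (2 : ℝ)⁻¹ ^ (n + 2)) * (1 - (2 : ℝ)⁻¹ ^ (n + 2)) := by nlinarith
      _ ≤ _ := by
        have h5 : (0 : ℝ) ≤ 1 - (2 : ℝ)⁻¹ ^ (n + 2) := by linarith
        have h6 : (0 : ℝ) ≤ KqTrunc q (n + 1) := by linarith
        gcongr

theorem KqTrunc_ge {q : ℕ} (hq : 2 ≤ q) (n : ℕ) : 1 / 4 ≤ KqTrunc q n := by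
  cases n with
  | zero => norm_num [KqTrunc]
  | succ n =>
    refine le_trans ?_ (KqTrunc_ge_aux hq n)
    have : (0 : ℝ) < (2 : ℝ)⁻¹ ^ (n + 2) := by positivity
    linarith

theorem KqTrunc_pos {q : ℕ} (hq : 2 ≤ q) (n : ℕ) : 0 < KqTrunc q n :=
  lt_of_lt_of_le (by norm_num) (KqTrunc_ge hq n)

theorem KqTrunc_antitone {q : ℕ} (hq : 2 ≤ q) : Antitone (KqTrunc q) := by
  refine antitone_nat_of_succ_le fun n => ?_
  rw [KqTrunc_succ]
  have h := (KqTrunc_pos hq n).le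
  have : (0 : ℝ) ≤ ((q : ℝ))⁻¹ ^ (n + 1) := by positivity
  nlinarith

theorem exists_tendsto_KqTrunc {q : ℕ} (hq : 2 ≤ q) :
    ∃ κ : ℝ, 0 < κ ∧ Tendsto (KqTrunc q) atTop (𝓝 κ) := by
  have h := tendsto_atTop_ciInf (KqTrunc_antitone hq)
    ⟨1 / 4, by rintro _ ⟨n, rfl⟩; exact KqTrunc_ge hq n⟩
  refine ⟨_, lt_of_lt_of_le (by norm_num) (ge_of_tendsto' h (KqTrunc_ge hq)), h⟩

theorem prod_pow_sub_pow {q : ℕ} (hq : 2 ≤ q) {n k : ℕ} (hk : k ≤ n) :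
    ((∏ i : Fin k, (q ^ n - q ^ i.val) : ℕ) : ℝ) * KqTrunc q (n - k) =
      (q : ℝ) ^ (n * k) * KqTrunc q n := by
  have hq0 : (q : ℝ) ≠ 0 := by positivity
  have h1 : KqTrunc q n = KqTrunc q (n - k) * ∏ i ∈ Finset.range k, (1 - ((q : ℝ))⁻¹ ^ (n - i)) := by
    conv_lhs => rw [show n = n - k + k by omega]
    rw [KqTrunc, Finset.prod_range_add, KqTrunc]
    congr 1
    rw [← Finset.prod_range_reflect]
    refine Finset.prod_congr rfl fun i hi => ?_
    have := Finset.mem_range.1 hi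
    congr 2
    omega
  have h2 : ((∏ i : Fin k, (q ^ n - q ^ i.val) : ℕ) : ℝ) =
      (q : ℝ) ^ (n * k) * ∏ i ∈ Finset.range k, (1 - ((q : ℝ))⁻¹ ^ (n - i)) := by
    rw [pow_mul, ← Finset.card_range k, ← Finset.prod_const, Finset.card_range,
      ← Finset.prod_mul_distrib, Fin.prod_univ_eq_prod_range (fun i => q ^ n - q ^ i) k]
    push_cast
    refine Finset.prod_congr rfl fun i hi => ?_
    have := Finset.mem_range.1 hi
    rw [Nat.cast_sub (Nat.pow_le_pow_right (by omega) (by omega))]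
    push_cast
    rw [mul_sub, mul_one, inv_pow]
    congr 1
    rw [eq_mul_inv_iff_mul_eq₀ (by positivity), ← pow_add]
    congr 1; omega
  rw [h1, h2]; ring

end KqTruncLemmas

section GrassmannianBounds

variable {F : Type} [Field F] [Fintype F] {V : Type} [AddCommGroup V] [Module F V] [Finite V]

theorem card_subspaces_eq {k : ℕ} (hk : k ≤ Module.finrank F V) :
    (Nat.card {W : Submodule F V // Module.finrank F W = k} : ℝ) =
      (Fintype.card F : ℝ) ^ (k * (Module.finrank F V - k)) *
        (KqTrunc (Fintype.card F) (Module.finrank F V) /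
          (KqTrunc (Fintype.card F) k * KqTrunc (Fintype.card F) (Module.finrank F V - k))) := by
  have hq : 2 ≤ Fintype.card F := Fintype.one_lt_card
  set q := Fintype.card F
  set n := Module.finrank F V
  have h := card_subspaces_mul_prod (F := F) (V := V) hk
  have h1 := prod_pow_sub_pow hq hk
  have h2 := prod_pow_sub_pow hq (le_refl k)
  rw [← h] at h1
  rw [Nat.sub_self] at h2
  have h0 : KqTrunc q 0 = 1 := by simp [KqTrunc]
  rw [h0, mul_one] at h2
  rw [Nat.cast_mul, h2] at h1
  have p1 := KqTrunc_pos hq k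
  have p2 := KqTrunc_pos hq (n - k)
  have hq0 : (0 : ℝ) < q := by positivity
  rw [mul_div_assoc', eq_div_iff (by positivity)]
  have hnk : n * k = k * (n - k) + k * k := by
    rw [← mul_add, Nat.sub_add_cancel hk, mul_comm]
  rw [hnk, pow_add] at h1
  have hp : (q : ℝ) ^ (k * k) ≠ 0 := by positivity
  apply mul_left_cancel₀ hp
  linarith

theorem card_subspaces_le {k b : ℕ} (hk : k + b = Module.finrank F V) :
    Nat.card {W : Submodule F V // Module.finrank F W = k} ≤ 4 * Fintype.card F ^ (k * b) := by
  have hq : 2 ≤ Fintype.card F := Fintype.one_lt_card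
  have h := card_subspaces_eq (F := F) (V := V) (k := k) (by omega)
  rw [show Module.finrank F V - k = b by omega] at h
  set q := Fintype.card F
  have : KqTrunc q (Module.finrank F V) / (KqTrunc q k * KqTrunc q b) ≤ 4 := by
    have p1 := KqTrunc_ge hq k
    have p2 := KqTrunc_pos hq b
    have p3 := KqTrunc_antitone hq (show b ≤ Module.finrank F V by omega)
    rw [div_le_iff₀ (by positivity)]
    nlinarith
  have hq0 : (0 : ℝ) < (q : ℝ) ^ (k * b) := by positivity
  have h2 : (Nat.card {W : Submodule F V // Module.finrank F W = k} : ℝ) ≤ 4 * (q : ℝ) ^ (k * b) := by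
    rw [h]; nlinarith
  exact_mod_cast h2

theorem card_subspaces_within_le (E : Submodule F V) {k b s : ℕ}
    (hk : k + b = Module.finrank F V) (hE : Module.finrank F E + s ≤ Module.finrank F V) :
    Nat.card {W : Submodule F V // Module.finrank F W = k ∧ W ≤ E} * Fintype.card F ^ (k * s) ≤
      4 * Fintype.card F ^ (k * b) := by
  have hle : Nat.card {W : Submodule F V // Module.finrank F W = k ∧ W ≤ E} ≤
      Nat.card {W : Submodule F E // Module.finrank F W = k} := by
    refine Nat.card_le_card_of_injective (fun W => ⟨W.1.comap E.subtype, ?_⟩) ?_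
    · rw [(Submodule.comapSubtypeEquivOfLe W.2.2).finrank_eq, W.2.1]
    · intro W W' h
      have h1 : W.1.comap E.subtype = W'.1.comap E.subtype := congrArg Subtype.val h
      have h2 := congrArg (Submodule.map E.subtype) h1
      rw [Submodule.map_comap_subtype, Submodule.map_comap_subtype, inf_eq_right.2 W.2.2,
        inf_eq_right.2 W'.2.2] at h2
      exact Subtype.ext h2
  by_cases hkE : k ≤ Module.finrank F E
  · obtain ⟨c, hc⟩ := Nat.exists_eq_add_of_le hkE
    have := card_subspaces_le (F := F) (V := E) (k := k) (b := c) hc.symm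
    have hq : 1 ≤ Fintype.card F := Fintype.card_pos
    calc _ ≤ 4 * Fintype.card F ^ (k * c) * Fintype.card F ^ (k * s) := by gcongr; omega
      _ = 4 * Fintype.card F ^ (k * (c + s)) := by rw [mul_assoc, ← pow_add, mul_add]
      _ ≤ _ := by gcongr; omega
  · have : IsEmpty {W : Submodule F E // Module.finrank F W = k} := by
      refine ⟨fun W => hkE ?_⟩
      rw [← W.2]; exact Submodule.finrank_le _
    rw [Nat.card_of_isEmpty (α := {W : Submodule F E // Module.finrank F W = k}),
      Nat.le_zero] at hle
    simp [hle]

end GrassmannianBounds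

section InvariantSubspaces

variable {F : Type} [Field F] {σ : F →+* F} {V : Type} [AddCommGroup V] [Module F V]

/-- The `k`-dimensional subspaces mapped into themselves by the semilinear map `T`. -/
def invSubspaces (T : V →ₛₗ[σ] V) (k : ℕ) : Set (Submodule F V) :=
  {W | Module.finrank F W = k ∧ ∀ w ∈ W, T w ∈ W}

/-- Every subspace on which `T` acts as a scalar has codimension at least `s`. -/
def EigenGap (T : V →ₛₗ[σ] V) (s : ℕ) : Prop :=
  ∀ (E : Submodule F V) (l : F), (∀ v ∈ E, T v = l • v) →
    Module.finrank F E + s ≤ Module.finrank F V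

/-- The smallest `T`-invariant subspace containing `w`. -/
def cyclicSubspace (T : V →ₛₗ[σ] V) (w : V) : Submodule F V :=
  sInf {P | w ∈ P ∧ ∀ v ∈ P, T v ∈ P}

theorem cyclicSubspace_le (T : V →ₛₗ[σ] V) {w : V} {P : Submodule F V} (hw : w ∈ P)
    (hP : ∀ v ∈ P, T v ∈ P) : cyclicSubspace T w ≤ P :=
  sInf_le ⟨hw, hP⟩

theorem mem_cyclicSubspace (T : V →ₛₗ[σ] V) (w : V) : w ∈ cyclicSubspace T w := by
  rw [cyclicSubspace, Submodule.mem_sInf]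
  exact fun P hP => hP.1

theorem apply_mem_cyclicSubspace (T : V →ₛₗ[σ] V) (w : V) :
    ∀ v ∈ cyclicSubspace T w, T v ∈ cyclicSubspace T w := by
  intro v hv
  rw [cyclicSubspace, Submodule.mem_sInf] at hv ⊢
  exact fun P hP => hP.2 _ (hv P hP)

theorem two_le_finrank_of_notMem_span [FiniteDimensional F V] {W : Submodule F V} {v w : V}
    (hv : v ∈ W) (hw : w ∈ W) (hv0 : v ≠ 0) (h : w ∉ Submodule.span F {v}) :
    2 ≤ Module.finrank F W := by
  have h1 : Submodule.span F {v} < W := by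
    refine lt_of_le_of_ne ?_ ?_
    · rw [Submodule.span_le]; simpa using hv
    · rintro rfl; exact h hw
  have := Submodule.finrank_lt_finrank_of_lt h1
  rw [finrank_span_singleton hv0] at this
  omega

theorem ne_zero_of_apply_notMem_span {T : V →ₛₗ[σ] V} {w : V}
    (h : T w ∉ Submodule.span F {w}) : w ≠ 0 := by
  rintro rfl
  simp at h

theorem two_le_finrank_cyclicSubspace [FiniteDimensional F V] {T : V →ₛₗ[σ] V} {w : V}
    (h : T w ∉ Submodule.span F {w}) : 2 ≤ Module.finrank F (cyclicSubspace T w) :=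
  two_le_finrank_of_notMem_span (mem_cyclicSubspace T w)
    (apply_mem_cyclicSubspace T w _ (mem_cyclicSubspace T w)) (ne_zero_of_apply_notMem_span h) h

/-- A semilinear map fixing every line of a subspace of dimension at least two is a scalar there. -/
theorem exists_scalar_of_forall_mem_span [FiniteDimensional F V] {T : V →ₛₗ[σ] V}
    {W : Submodule F V} (hW : 2 ≤ Module.finrank F W)
    (h : ∀ w ∈ W, T w ∈ Submodule.span F {w}) : ∃ l : F, ∀ w ∈ W, T w = l • w := by
  have key : ∀ v ∈ W, v ≠ 0 → ∀ l : F, T v = l • v → ∀ w ∈ W, w ∉ Submodule.span F {v} →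
      T w = l • w := by
    intro v hv hv0 l hl w hw hvw
    obtain ⟨m, hm⟩ := Submodule.mem_span_singleton.1 (h w hw)
    obtain ⟨c, hc⟩ := Submodule.mem_span_singleton.1 (h (w + v) (W.add_mem hw hv))
    rw [map_add, hl, ← hm, smul_add] at hc
    have h1 : (c - m) • w = (l - c) • v := by
      rw [sub_smul, sub_smul, sub_eq_sub_iff_add_eq_add, hc, add_comm]
    have h2 : c = m := by
      by_contra hne
      apply hvw
      rw [Submodule.mem_span_singleton]
      refine ⟨(c - m)⁻¹ * (l - c), ?_⟩
      rw [mul_smul, ← h1, smul_smul, inv_mul_cancel₀ (sub_ne_zero.2 hne), one_smul]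
    have h3 : l = c := by
      rw [h2, sub_self, zero_smul] at h1
      rw [← h2] at h1
      exact sub_eq_zero.1 ((smul_eq_zero.1 h1.symm).resolve_right hv0)
    rw [h3, h2, hm]
  have hbot : W ≠ ⊥ := by rintro rfl; simp at hW
  obtain ⟨v, hv, hv0⟩ := Submodule.exists_mem_ne_zero_of_ne_bot hbot
  obtain ⟨l, hl⟩ := Submodule.mem_span_singleton.1 (h v hv)
  have hex : ∃ w ∈ W, w ∉ Submodule.span F {v} := by
    by_contra hcon
    push Not at hcon
    have := Submodule.finrank_mono (R := F) (s := W) (t := Submodule.span F {v}) hcon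
    rw [finrank_span_singleton hv0] at this
    omega
  obtain ⟨u, hu, huv⟩ := hex
  have hu0 : u ≠ 0 := by rintro rfl; simp at huv
  have hTu := key v hv hv0 l hl.symm u hu huv
  refine ⟨l, fun w hw => ?_⟩
  by_cases hwv : w ∈ Submodule.span F {v}
  · obtain ⟨c, rfl⟩ := Submodule.mem_span_singleton.1 hwv
    by_cases hc : c = 0
    · simp [hc]
    refine key u hu hu0 l hTu _ hw fun hmem => huv ?_
    obtain ⟨d, hd⟩ := Submodule.mem_span_singleton.1 hmem
    have hd0 : d ≠ 0 := by
      rintro rfl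
      rw [zero_smul] at hd
      exact (smul_ne_zero hc hv0) hd.symm
    rw [Submodule.mem_span_singleton]
    refine ⟨d⁻¹ * c, ?_⟩
    rw [mul_smul, ← hd, smul_smul, inv_mul_cancel₀ hd0, one_smul]
  · exact key v hv hv0 l hl.symm w hw hwv

theorem mapQ_injective [Finite V] {T : V →ₛₗ[σ] V} (hT : Function.Injective T) {P : Submodule F V}
    (hP : P ≤ P.comap T) : Function.Injective (P.mapQ P T hP) := by
  rw [injective_iff_map_eq_zero]
  intro x hx
  obtain ⟨v, rfl⟩ := P.mkQ_surjective x
  have hv : T v ∈ P := by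
    rw [← Submodule.Quotient.mk_eq_zero P]; exact hx
  have hsurj : Function.Surjective (fun p : P => (⟨T p.1, hP p.2⟩ : P)) :=
    Finite.injective_iff_surjective.1 fun a b h => Subtype.ext (hT (congrArg Subtype.val h))
  obtain ⟨p, hp⟩ := hsurj ⟨T v, hv⟩
  have : p.1 = v := hT (congrArg Subtype.val hp)
  rw [Submodule.mkQ_apply, Submodule.Quotient.mk_eq_zero, ← this]
  exact p.2

theorem EigenGap.mapQ [Finite V] {T : V →ₛₗ[σ] V} (hT : Function.Injective T) {s : ℕ}
    (h : EigenGap T s) {P : Submodule F V} (hP : P ≤ P.comap T) (hs : Module.finrank F P ≤ s) :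
    EigenGap (P.mapQ P T hP) (s - Module.finrank F P) := by
  intro E l hE
  have hn := Submodule.finrank_quotient_add_finrank P
  by_cases hσ : σ = RingHom.id F
  · subst hσ
    let E' := E.comap P.mkQ
    have hPE : P ≤ E' := by
      intro v hv
      simp [E', (Submodule.Quotient.mk_eq_zero P).2 hv]
    have hE' : ∀ v ∈ E', T v - l • v ∈ P := by
      intro v hv
      have := hE _ hv
      rw [← Submodule.Quotient.eq]
      exact this
    let f : E' →ₗ[F] P :=
      LinearMap.codRestrict P ((T - l • LinearMap.id).comp E'.subtype) fun v => hE' v.1 v.2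
    have hker : Module.finrank F (LinearMap.ker f) + s ≤ Module.finrank F V := by
      rw [← Submodule.finrank_map_subtype_eq E' (LinearMap.ker f)]
      refine h _ l ?_
      rintro _ ⟨v, hv, rfl⟩
      have : f v = 0 := hv
      have h1 := congrArg Subtype.val this
      exact sub_eq_zero.1 h1
    have hf := LinearMap.finrank_range_add_finrank_ker f
    have hr := Submodule.finrank_le (LinearMap.range f)
    have hE'd : Module.finrank F E' = Module.finrank F E + Module.finrank F P := by
      have h1 := Submodule.finrank_quotient_add_finrank (P.comap E'.subtype)
      have h2 := (Submodule.comapSubtypeEquivOfLe hPE).finrank_eq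
      have h3 : Module.finrank F E = Module.finrank F (E' ⧸ P.comap E'.subtype) := by
        let g : E' →ₗ[F] E := P.mkQ.restrict (p := E') (q := E) fun v hv => hv
        have hg : Function.Surjective g := by
          rintro ⟨x, hx⟩
          obtain ⟨v, rfl⟩ := P.mkQ_surjective x
          exact ⟨⟨v, hx⟩, rfl⟩
        have hgk : LinearMap.ker g = P.comap E'.subtype := by
          ext v
          rw [LinearMap.mem_ker, Submodule.mem_comap, ← Submodule.Quotient.mk_eq_zero P]
          exact Subtype.ext_iff
        have h4 := LinearMap.finrank_range_add_finrank_ker g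
        rw [LinearMap.range_eq_top.2 hg, finrank_top, hgk] at h4
        omega
      omega
    omega
  · have hEbot : E = ⊥ := by
      rw [Submodule.eq_bot_iff]
      intro x hx
      obtain ⟨c, hc⟩ : ∃ c, σ c ≠ c := by
        by_contra hcon
        push Not at hcon
        exact hσ (RingHom.ext hcon)
      have h1 := hE _ (E.smul_mem c hx)
      rw [map_smulₛₗ, hE x hx, smul_smul, smul_smul, ← sub_eq_zero, ← sub_smul] at h1
      rcases smul_eq_zero.1 h1 with h2 | h2
      · have h3 : l * (σ c - c) = 0 := by linear_combination h2
        rcases mul_eq_zero.1 h3 with h4 | h4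
        · have h5 := hE x hx
          rw [h4, zero_smul] at h5
          exact (injective_iff_map_eq_zero _).1 (mapQ_injective hT hP) x h5
        · exact absurd (sub_eq_zero.1 h4) hc
      · exact h2
    have h0 := h ⊥ 0 (by simp)
    rw [hEbot, finrank_bot]
    rw [finrank_bot] at h0
    omega

end InvariantSubspaces

/-- Invariant subspaces through `w` come from invariant subspaces of a quotient. -/
theorem card_invSubspaces_mem_le {F : Type} [Field F] {σ : F →+* F} {V : Type} [AddCommGroup V]
    [Module F V] [Finite V] (T : V →ₛₗ[σ] V) (w : V) (k : ℕ) :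
    Nat.card {W : Submodule F V // W ∈ invSubspaces T k ∧ w ∈ W} ≤
      Nat.card (invSubspaces ((cyclicSubspace T w).mapQ _ T (apply_mem_cyclicSubspace T w))
        (k - Module.finrank F (cyclicSubspace T w))) := by
  set P := cyclicSubspace T w with hPdef
  have hle : ∀ W : {W : Submodule F V // W ∈ invSubspaces T k ∧ w ∈ W}, P ≤ W.1 :=
    fun W => cyclicSubspace_le T W.2.2 W.2.1.2
  have : Finite (V ⧸ P) := Finite.of_surjective _ P.mkQ_surjective
  have : Finite (invSubspaces (P.mapQ P T (apply_mem_cyclicSubspace T w))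
      (k - Module.finrank F P)) := (Set.toFinite _).to_subtype
  refine Nat.card_le_card_of_injective (fun W => ⟨W.1.map P.mkQ, ?_, ?_⟩) ?_
  · have h1 := LinearMap.finrank_range_add_finrank_ker (P.mkQ.comp W.1.subtype)
    rw [LinearMap.range_comp, Submodule.range_subtype, LinearMap.ker_comp, Submodule.ker_mkQ,
      (Submodule.comapSubtypeEquivOfLe (hle W)).finrank_eq, W.2.1.1] at h1
    exact Nat.eq_sub_of_add_eq h1
  · rintro _ ⟨v, hv, rfl⟩
    exact ⟨T v, W.2.1.2 v hv, rfl⟩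
  · intro W W' h
    have h1 : W.1.map P.mkQ = W'.1.map P.mkQ := congrArg Subtype.val h
    have h2 := congrArg (Submodule.comap P.mkQ) h1
    rw [Submodule.comap_map_mkQ, Submodule.comap_map_mkQ, sup_eq_right.2 (hle W),
      sup_eq_right.2 (hle W')] at h2
    exact Subtype.ext h2

section InvariantCount

variable {F : Type} [Field F] [Fintype F] {σ : F →+* F} {V : Type} [AddCommGroup V] [Module F V]
  [Finite V]

/-- A positive proportion of vectors of `W` span a line not preserved by `T`, once one does. -/
theorem card_le_sq_mul_card_notMem_span (T : V →ₛₗ[σ] V) {W : Submodule F V}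
    (hW : ∀ w ∈ W, T w ∈ W) {w₀ : V} (hw₀ : w₀ ∈ W) (h : T w₀ ∉ Submodule.span F {w₀}) :
    Fintype.card F ^ Module.finrank F W ≤
      Nat.card {w // w ∈ W ∧ T w ∉ Submodule.span F {w}} * Fintype.card F ^ 2 := by
  classical
  have hex : ∀ v : W, ∃ c : F × F, T (v.1 - (c.1 • w₀ + c.2 • T w₀)) ∉
      Submodule.span F {v.1 - (c.1 • w₀ + c.2 • T w₀)} := by
    rintro ⟨v, hv⟩
    by_contra hcon
    push Not at hcon
    by_cases hvP : ∃ c : F × F, c.1 • w₀ + c.2 • T w₀ = v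
    · obtain ⟨c, hc⟩ := hvP
      apply h
      have := hcon (c.1 - 1, c.2)
      have h2 : v - ((c.1 - 1) • w₀ + c.2 • T w₀) = w₀ := by
        rw [← hc, sub_smul, one_smul]; abel
      dsimp only at this
      rwa [h2] at this
    · have h1 := hcon (0, 0)
      have h2 := hcon (-1, 0)
      simp only [zero_smul, add_zero, sub_zero, neg_smul, one_smul, sub_neg_eq_add] at h1 h2
      obtain ⟨m, hm⟩ := Submodule.mem_span_singleton.1 h1
      obtain ⟨c, hc⟩ := Submodule.mem_span_singleton.1 h2
      rw [map_add, ← hm, smul_add] at hc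
      have h3 : T w₀ = (c - m) • v + c • w₀ := by
        rw [sub_smul]
        rw [← sub_eq_iff_eq_add'] at hc
        rw [← hc]; abel
      by_cases hcm : c - m = 0
      · apply h
        rw [Submodule.mem_span_singleton]
        exact ⟨c, by rw [h3, hcm]; simp⟩
      · apply hvP
        refine ⟨(-((c - m)⁻¹ * c), (c - m)⁻¹), ?_⟩
        rw [h3]
        simp only [smul_add, smul_smul, inv_mul_cancel₀ hcm, one_smul, neg_smul]
        abel
  choose c hc using hex
  let f : W → {w // w ∈ W ∧ T w ∉ Submodule.span F {w}} × (F × F) := fun v =>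
    (⟨v.1 - ((c v).1 • w₀ + (c v).2 • T w₀),
      W.sub_mem v.2 (W.add_mem (W.smul_mem _ hw₀) (W.smul_mem _ (hW _ hw₀))), hc v⟩, c v)
  have hf : Function.Injective f := by
    intro v v' hvv
    have h1 : c v = c v' := congrArg Prod.snd hvv
    have h2 : v.1 - ((c v).1 • w₀ + (c v).2 • T w₀) =
      v'.1 - ((c v').1 • w₀ + (c v').2 • T w₀) := congrArg (fun z => (Prod.fst z).1) hvv
    rw [h1] at h2
    exact Subtype.ext (sub_left_injective h2)
  have := Nat.card_le_card_of_injective f hf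
  rw [Nat.card_prod, Nat.card_prod, Nat.card_eq_fintype_card (α := F),
    Module.natCard_eq_pow_finrank (K := F), Nat.card_eq_fintype_card (α := F), ← sq] at this
  exact this

theorem card_invSubspaces_le (T : V →ₛₗ[σ] V) {k b : ℕ} (hk : k + b = Module.finrank F V) :
    Nat.card (invSubspaces T k) ≤ 4 * Fintype.card F ^ (k * b) :=
  le_trans (Nat.card_le_card_of_injective
    (fun W => (⟨W.1, W.2.1⟩ : {W : Submodule F V // Module.finrank F W = k}))
    fun _ _ h => Subtype.ext (Subtype.mk.inj h))
    (card_subspaces_le hk)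

/-- Invariant subspaces on which `T` is scalar. -/
theorem card_scalar_invSubspaces_le (T : V →ₛₗ[σ] V) {s k b : ℕ}
    (hgap : EigenGap T s) (hk : k + b = Module.finrank F V) (hk2 : 2 ≤ k) :
    Nat.card {W : Submodule F V // W ∈ invSubspaces T k ∧ ∀ w ∈ W, T w ∈ Submodule.span F {w}} *
      Fintype.card F ^ (k * s) ≤ 4 * Fintype.card F * Fintype.card F ^ (k * b) := by
  classical
  have hex : ∀ l : F, ∃ E : Submodule F V, Module.finrank F E + s ≤ Module.finrank F V ∧
      ∀ W : Submodule F V, (∀ w ∈ W, T w = l • w) → W ≤ E := by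
    intro l
    refine ⟨sSup {W | ∀ w ∈ W, T w = l • w}, hgap _ l ?_, fun W hW => le_sSup hW⟩
    intro v hv
    rw [sSup_eq_iSup'] at hv
    induction hv using Submodule.iSup_induction' with
    | mem W x hx => exact W.2 x hx
    | zero => simp
    | add x y _ _ hx hy => rw [map_add, hx, hy, smul_add]
  choose E hE hWE using hex
  let A := {W : Submodule F V // W ∈ invSubspaces T k ∧ ∀ w ∈ W, T w ∈ Submodule.span F {w}}
  have hl : ∀ W : A, ∃ l : F, ∀ w ∈ W.1, T w = l • w := fun W =>
    exists_scalar_of_forall_mem_span (by rw [W.2.1.1]; exact hk2) W.2.2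
  choose l hl using hl
  let f : A → Σ l : F, {W : Submodule F V // Module.finrank F W = k ∧ W ≤ E l} :=
    fun W => ⟨l W, W.1, W.2.1.1, hWE _ _ (hl W)⟩
  have hf : Function.Injective f := by
    intro W W' h
    exact Subtype.ext (congrArg (fun z => z.2.1) h)
  have h1 := Nat.card_le_card_of_injective f hf
  rw [Nat.card_sigma] at h1
  calc Nat.card A * Fintype.card F ^ (k * s)
      ≤ (∑ l : F, Nat.card {W : Submodule F V // Module.finrank F W = k ∧ W ≤ E l}) *
          Fintype.card F ^ (k * s) := Nat.mul_le_mul_right _ h1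
    _ = ∑ l : F, Nat.card {W : Submodule F V // Module.finrank F W = k ∧ W ≤ E l} *
          Fintype.card F ^ (k * s) := Finset.sum_mul _ _ _
    _ ≤ ∑ _l : F, 4 * Fintype.card F ^ (k * b) :=
        Finset.sum_le_sum fun l _ => card_subspaces_within_le (E l) hk (hE l)
    _ = _ := by simp; ring

/-- Double counting of pairs of a non-scalar invariant subspace and a vector of it spanning a
line that is not preserved. -/
theorem card_nonscalar_invSubspaces_le (T : V →ₛₗ[σ] V) {k M t : ℕ}
    (hM : ∀ w : V, T w ∉ Submodule.span F {w} →
      Nat.card {W : Submodule F V // W ∈ invSubspaces T k ∧ w ∈ W} * t ≤ M) :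
    Nat.card {W : Submodule F V // W ∈ invSubspaces T k ∧
      ¬ ∀ w ∈ W, T w ∈ Submodule.span F {w}} * t * Fintype.card F ^ k ≤
    Fintype.card F ^ 2 * Fintype.card F ^ Module.finrank F V * M := by
  classical
  have : Fintype V := Fintype.ofFinite V
  have : Fintype (Submodule F V) := Fintype.ofFinite _
  let S : Finset (Submodule F V) := Finset.univ.filter fun W => W ∈ invSubspaces T k ∧
      ¬ ∀ w ∈ W, T w ∈ Submodule.span F {w}
  let U : Finset V := Finset.univ.filter fun w => T w ∉ Submodule.span F {w}
  have hdc := Finset.sum_card_bipartiteAbove_eq_sum_card_bipartiteBelow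
    (fun (W : Submodule F V) (w : V) => w ∈ W) (s := S) (t := U)
  have h1 : ∀ W ∈ S, Fintype.card F ^ k ≤
      (U.bipartiteAbove (fun (W : Submodule F V) (w : V) => w ∈ W) W).card * Fintype.card F ^ 2 := by
    intro W hW
    obtain ⟨hWk, hWn⟩ := (Finset.mem_filter.1 hW).2
    push Not at hWn
    obtain ⟨w₀, hw₀, hw₀'⟩ := hWn
    have := card_le_sq_mul_card_notMem_span T hWk.2 hw₀ hw₀'
    rw [hWk.1] at this
    convert this using 2
    rw [Nat.card_eq_fintype_card, Fintype.card_subtype, Finset.bipartiteAbove, Finset.filter_filter]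
    simp only [and_comm]
  have h2 : ∀ w ∈ U, (S.bipartiteBelow (fun (W : Submodule F V) (w : V) => w ∈ W) w).card * t ≤
      M := by
    intro w hw
    refine le_trans (Nat.mul_le_mul_right _ ?_) (hM w (Finset.mem_filter.1 hw).2)
    rw [Nat.card_eq_fintype_card, Fintype.card_subtype, Finset.bipartiteBelow,
      Finset.filter_filter]
    refine Finset.card_le_card fun W => ?_
    simp only [Finset.mem_filter, Finset.mem_univ, true_and]
    exact fun h => ⟨h.1.1, h.2⟩
  have hS : Nat.card {W : Submodule F V // W ∈ invSubspaces T k ∧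
      ¬ ∀ w ∈ W, T w ∈ Submodule.span F {w}} = S.card := by
    rw [Nat.card_eq_fintype_card, Fintype.card_subtype]
  rw [hS]
  calc S.card * t * Fintype.card F ^ k = (∑ _W ∈ S, Fintype.card F ^ k) * t := by
        rw [Finset.sum_const, smul_eq_mul]; ring
    _ ≤ (∑ W ∈ S, (U.bipartiteAbove (fun (W : Submodule F V) (w : V) => w ∈ W) W).card *
          Fintype.card F ^ 2) * t := Nat.mul_le_mul_right _ (Finset.sum_le_sum h1)
    _ = Fintype.card F ^ 2 * ∑ w ∈ U,
          (S.bipartiteBelow (fun (W : Submodule F V) (w : V) => w ∈ W) w).card * t := by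
        rw [← Finset.sum_mul, hdc, ← Finset.sum_mul]; ring
    _ ≤ Fintype.card F ^ 2 * ∑ _w ∈ U, M := Nat.mul_le_mul_left _ (Finset.sum_le_sum h2)
    _ = Fintype.card F ^ 2 * (U.card * M) := by rw [Finset.sum_const, smul_eq_mul]
    _ ≤ Fintype.card F ^ 2 * (Fintype.card F ^ Module.finrank F V * M) := by
        gcongr
        rw [← Module.card_eq_pow_finrank (K := F) (V := V)]
        exact Finset.card_le_univ U
    _ = _ := by ring

end InvariantCount

section InvariantBound

variable {F : Type} [Field F] [Fintype F]

/-- A semilinear injection that is far from every scalar has few invariant subspaces. -/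
theorem card_invSubspaces_mul_le {σ : F →+* F} (s : ℕ) : ∀ {V : Type} [AddCommGroup V] [Module F V]
    [Finite V] {T : V →ₛₗ[σ] V} (_ : Function.Injective T) (_ : EigenGap T s) {k b δ : ℕ}
    (_ : k + b = Module.finrank F V) (_ : 2 * δ ≤ b) (_ : δ + s ≤ k) (_ : 2 ≤ δ),
    Nat.card (invSubspaces T k) * Fintype.card F ^ (s * δ) ≤
      (8 * Fintype.card F ^ 2) ^ (s + 1) * Fintype.card F ^ (k * b) := by
  have hq : 2 ≤ Fintype.card F := Fintype.one_lt_card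
  have hq2 : Fintype.card F ≤ Fintype.card F ^ 2 := Nat.le_self_pow two_ne_zero _
  induction s using Nat.strong_induction_on with
  | _ s ih =>
  intro V _ _ _ T hT hgap k b δ hk hb hs hδ
  have hk2 : 2 ≤ k := by omega
  set q := Fintype.card F with hqdef
  set K := 8 * q ^ 2 with hK
  have hK1 : 1 ≤ K := by nlinarith
  rcases Nat.eq_zero_or_pos s with rfl | hs0
  · have h := card_invSubspaces_le T hk
    rw [zero_mul, pow_zero, mul_one, zero_add, pow_one]
    refine h.trans (Nat.mul_le_mul_right _ ?_)
    nlinarith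
  have hM : ∀ w : V, T w ∉ Submodule.span F {w} →
      Nat.card {W : Submodule F V // W ∈ invSubspaces T k ∧ w ∈ W} * q ^ (s * δ) ≤
        4 * K ^ (s - 1) * q ^ ((k - 1) * b) := by
    intro w hw
    have hd2 := two_le_finrank_cyclicSubspace hw
    by_cases hdk : Module.finrank F (cyclicSubspace T w) ≤ k
    swap
    · have : IsEmpty {W : Submodule F V // W ∈ invSubspaces T k ∧ w ∈ W} := by
        refine ⟨fun W => hdk ?_⟩
        rw [← W.2.1.1]
        exact Submodule.finrank_mono (cyclicSubspace_le T W.2.2 W.2.1.2)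
      simp
    have hle := card_invSubspaces_mem_le T w k
    have hfin : Finite (V ⧸ cyclicSubspace T w) := Finite.of_surjective _ (Submodule.mkQ_surjective _)
    have hdim : k - Module.finrank F (cyclicSubspace T w) + b = Module.finrank F (V ⧸ cyclicSubspace T w) := by
      have := Submodule.finrank_quotient_add_finrank (cyclicSubspace T w)
      omega
    obtain ⟨d, hd⟩ : ∃ d, Module.finrank F (cyclicSubspace T w) = d := ⟨_, rfl⟩
    rw [hd] at hd2 hdk
    have hexp : ∀ e, e + b ≤ d * b → (k - d) * b + e ≤ (k - 1) * b := by
      intro e he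
      obtain ⟨c, rfl⟩ := Nat.exists_eq_add_of_le hdk
      obtain ⟨d', rfl⟩ := Nat.exists_eq_add_of_le (show 1 ≤ d by omega)
      rw [show 1 + d' + c - (1 + d') = c by omega, show 1 + d' + c - 1 = d' + c by omega]
      nlinarith
    refine (Nat.mul_le_mul_right _ hle).trans ?_
    by_cases hds : d ≤ s
    · have hlt : s - Module.finrank F (cyclicSubspace T w) < s := by omega
      have hmain := ih (s - Module.finrank F (cyclicSubspace T w)) hlt
        (mapQ_injective hT (apply_mem_cyclicSubspace T w)) (hgap.mapQ hT _ (hd.trans_le hds)) (δ := δ)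
        hdim hb (by omega) hδ
      rw [hd] at hmain ⊢
      calc _ = _ * q ^ ((s - d) * δ) * q ^ (d * δ) := by
            rw [mul_assoc, ← pow_add, ← add_mul, Nat.sub_add_cancel hds]
        _ ≤ K ^ (s - d + 1) * q ^ ((k - d) * b) * q ^ (d * δ) := Nat.mul_le_mul_right _ hmain
        _ = K ^ (s - d + 1) * q ^ ((k - d) * b + d * δ) := by rw [mul_assoc, ← pow_add]
        _ ≤ 4 * K ^ (s - 1) * q ^ ((k - 1) * b) := by
          have h1 : K ^ (s - d + 1) ≤ 4 * K ^ (s - 1) :=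
            (Nat.pow_le_pow_right hK1 (by omega)).trans (Nat.le_mul_of_pos_left _ (by norm_num))
          have h2 := hexp (d * δ) (by nlinarith)
          gcongr
          omega
    · have hmain := card_invSubspaces_le
        (Submodule.mapQ _ _ T (apply_mem_cyclicSubspace T w)) hdim
      rw [hd] at hmain ⊢
      calc _ ≤ 4 * q ^ ((k - d) * b) * q ^ (s * δ) := Nat.mul_le_mul_right _ hmain
        _ = 4 * q ^ ((k - d) * b + s * δ) := by rw [mul_assoc, ← pow_add]
        _ ≤ 4 * K ^ (s - 1) * q ^ ((k - 1) * b) := by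
          have h1 : 4 ≤ 4 * K ^ (s - 1) := Nat.le_mul_of_pos_right _ (by positivity)
          have h2 := hexp (s * δ) (by
            have : s + 1 ≤ d := by omega
            nlinarith)
          gcongr
          omega
  have hN := card_nonscalar_invSubspaces_le T hM
  have hS := card_scalar_invSubspaces_le T hgap hk hk2
  have hsplit : Nat.card (invSubspaces T k) =
      Nat.card {W : Submodule F V // W ∈ invSubspaces T k ∧
        ∀ w ∈ W, T w ∈ Submodule.span F {w}} +
      Nat.card {W : Submodule F V // W ∈ invSubspaces T k ∧
        ¬ ∀ w ∈ W, T w ∈ Submodule.span F {w}} := by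
    classical
    have : Fintype (Submodule F V) := Fintype.ofFinite _
    have h1 : Nat.card (invSubspaces T k) = Nat.card {W : Submodule F V // W ∈ invSubspaces T k} :=
      rfl
    rw [h1]
    simp only [Nat.card_eq_fintype_card, Fintype.card_subtype]
    rw [← Finset.filter_filter, ← Finset.filter_filter, Finset.card_filter_add_card_filter_not]
  set A := Nat.card {W : Submodule F V // W ∈ invSubspaces T k ∧
        ∀ w ∈ W, T w ∈ Submodule.span F {w}}
  set B := Nat.card {W : Submodule F V // W ∈ invSubspaces T k ∧
        ¬ ∀ w ∈ W, T w ∈ Submodule.span F {w}}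
  have hA : A * q ^ (s * δ) ≤ 4 * q ^ 2 * K ^ (s - 1) * q ^ (k * b) := by
    calc A * q ^ (s * δ) ≤ A * q ^ (k * s) := by
          have : s * δ ≤ k * s := by nlinarith
          gcongr; omega
      _ ≤ 4 * q * q ^ (k * b) := hS
      _ ≤ 4 * q ^ 2 * q ^ (k * b) := by gcongr
      _ ≤ _ := by
        refine Nat.mul_le_mul_right _ (Nat.le_mul_of_pos_right _ (by positivity))
  have hB : B * q ^ (s * δ) ≤ 4 * q ^ 2 * K ^ (s - 1) * q ^ (k * b) := by
    refine Nat.le_of_mul_le_mul_right ?_ (show 0 < q ^ k by positivity)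
    refine hN.trans (le_of_eq ?_)
    obtain ⟨k', rfl⟩ := Nat.exists_eq_add_of_le (show 1 ≤ k by omega)
    rw [← hk, Nat.add_sub_cancel_left]
    ring
  rw [hsplit, add_mul]
  calc _ ≤ 8 * q ^ 2 * K ^ (s - 1) * q ^ (k * b) := by linarith
    _ = K ^ (s - 1 + 1) * q ^ (k * b) := by rw [pow_succ' K]
    _ ≤ K ^ (s + 1) * q ^ (k * b) := by gcongr; omega

end InvariantBound

/-- The indices where `φ` differs from the scalar pattern `i ↦ (i, l)`. -/
def displaced {F : Type} {n : ℕ} [DecidableEq F] (l : F) (φ : Fin n → Fin n × F) : Finset (Fin n) :=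
  Finset.univ.filter fun i => φ i ≠ (i, l)

/-- Generating function of the number of displaced indices. -/
theorem sum_pow_card_displaced {F : Type} {n : ℕ} [Fintype F] [DecidableEq F] (l : F) (y : ℝ) :
    ∑ φ : Fin n → Fin n × F, y ^ (displaced l φ).card =
      (1 + (n * Fintype.card F - 1) * y) ^ n := by
  have h1 : ∀ φ : Fin n → Fin n × F, y ^ (displaced l φ).card =
      ∏ i, if φ i = (i, l) then 1 else y := by
    intro φ
    rw [Finset.prod_ite, Finset.prod_const_one, one_mul, Finset.prod_const]
    rfl
  simp_rw [h1]
  rw [← Fintype.piFinset_univ, ← Finset.prod_univ_sum (fun _ => Finset.univ)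
    (fun i (x : Fin n × F) => if x = (i, l) then (1 : ℝ) else y)]
  have h2 : ∀ i : Fin n, ∑ x : Fin n × F, (if x = (i, l) then (1 : ℝ) else y) =
      1 + (n * Fintype.card F - 1) * y := by
    intro i
    have h3 : ∀ x : Fin n × F, (if x = (i, l) then (1 : ℝ) else y) =
        (if x = (i, l) then 1 - y else 0) + y := by
      intro x; split_ifs <;> ring
    simp_rw [h3, Finset.sum_add_distrib]
    simp
    ring
  simp [h2]

section SemimonomialMaps

variable {F : Type} [Field F] {n : ℕ}

/-- The semilinear map `x ↦ (a i * σ (x (π i)))_i`. -/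
def semimonomialMap (σ : F ≃+* F) (π : Equiv.Perm (Fin n)) (a : Fin n → F) :
    (Fin n → F) →ₛₗ[(σ : F →+* F)] (Fin n → F) where
  toFun x i := a i * σ (x (π i))
  map_add' x y := by ext i; simp [mul_add]
  map_smul' c x := by ext i; simp; ring

@[simp]
theorem semimonomialMap_apply (σ : F ≃+* F) (π : Equiv.Perm (Fin n)) (a x : Fin n → F)
    (i : Fin n) : semimonomialMap σ π a x i = a i * σ (x (π i)) := rfl

theorem semimonomialMap_injective (σ : F ≃+* F) (π : Equiv.Perm (Fin n)) {a : Fin n → F}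
    (ha : ∀ i, a i ≠ 0) : Function.Injective (semimonomialMap σ π a) := by
  intro x y h
  ext i
  have := congrFun h (π.symm i)
  simpa [ha] using this

theorem exists_independent_subset (π : Equiv.Perm (Fin n)) (D : Finset (Fin n)) :
    ∃ I ⊆ D, (∀ i ∈ I, π i ∈ I → π i = i) ∧ D.card ≤ 3 * I.card := by
  classical
  obtain ⟨I, hI, hmax⟩ := Finset.exists_max_image
    (D.powerset.filter fun I => ∀ i ∈ I, π i ∈ I → π i = i) Finset.card ⟨∅, by simp⟩
  rw [Finset.mem_filter, Finset.mem_powerset] at hI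
  refine ⟨I, hI.1, hI.2, ?_⟩
  have hcover : D ⊆ (I ∪ I.image π) ∪ I.image π.symm := by
    intro i hi
    by_contra hni
    simp only [Finset.mem_union, Finset.mem_image, not_or] at hni
    obtain ⟨⟨h1, h2⟩, h3⟩ := hni
    have := hmax (insert i I) (by
      rw [Finset.mem_filter, Finset.mem_powerset]
      refine ⟨Finset.insert_subset hi hI.1, fun j hj hπ => ?_⟩
      rw [Finset.mem_insert] at hj hπ
      rcases hj with rfl | hj
      · rcases hπ with hπ | hπ
        · exact hπ
        · exact absurd ⟨π j, hπ, by simp⟩ h3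
      · rcases hπ with hπ | hπ
        · exact absurd ⟨j, hj, hπ⟩ h2
        · exact hI.2 j hj hπ)
    rw [Finset.card_insert_of_notMem h1] at this
    omega
  have h1 := Finset.card_le_card hcover
  have h2 := Finset.card_union_le (I ∪ I.image π) (I.image π.symm)
  have h3 := Finset.card_union_le I (I.image π)
  have h4 := Finset.card_image_le (s := I) (f := π)
  have h5 := Finset.card_image_le (s := I) (f := π.symm)
  omega

theorem eigenGap_semimonomialMap_refl [DecidableEq F] (π : Equiv.Perm (Fin n)) {a : Fin n → F}
    (ha : ∀ i, a i ≠ 0) {s : ℕ}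
    (hs : ∀ l : F, 3 * s ≤ (displaced l fun i => (π i, a i)).card + 2) :
    EigenGap (semimonomialMap (RingEquiv.refl F) π a) s := by
  intro E l hE
  obtain ⟨I, hID, hI, hcard⟩ := exists_independent_subset π (displaced l fun i => (π i, a i))
  have hsI : s ≤ I.card := by have := hs l; omega
  let g : E →ₗ[F] ({i // i ∉ I} → F) := LinearMap.funLeft F F Subtype.val ∘ₗ E.subtype
  have hg : Function.Injective g := by
    rw [injective_iff_map_eq_zero]
    rintro ⟨x, hx⟩ h0
    have h1 : ∀ i ∉ I, x i = 0 := fun i hi => congrFun h0 ⟨i, hi⟩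
    have h2 : ∀ i, a i * x (π i) = l * x i := fun i => congrFun (hE x hx) i
    rw [Submodule.mk_eq_zero]
    by_cases hl : l = 0
    · ext i
      have := h2 (π.symm i)
      simpa [hl, ha] using this
    ext i
    by_cases hi : i ∈ I
    · by_cases hπ : π i = i
      · have h3 := h2 i
        rw [hπ, ← sub_eq_zero, ← sub_mul] at h3
        refine (mul_eq_zero.1 h3).resolve_left fun h4 => ?_
        have := hID hi
        simp only [displaced, Finset.mem_filter, Finset.mem_univ, true_and] at this
        exact this (by rw [hπ, sub_eq_zero.1 h4])
      · have h3 := h2 i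
        rw [h1 (π i) fun h => hπ (hI i hi h), mul_zero] at h3
        exact (mul_eq_zero.1 h3.symm).resolve_left hl
    · exact h1 i hi
  have hle := LinearMap.finrank_le_finrank_of_injective hg
  rw [Module.finrank_fintype_fun_eq_card, Fintype.card_subtype_compl] at hle
  simp only [Fintype.card_fin, Fintype.card_coe] at hle
  have := Finset.card_le_univ I
  rw [Fintype.card_fin] at this
  rw [Module.finrank_fintype_fun_eq_card, Fintype.card_fin]
  omega

theorem eigenGap_semimonomialMap_of_ne {σ : F ≃+* F} (hσ : σ ≠ RingEquiv.refl F)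
    (π : Equiv.Perm (Fin n)) {a : Fin n → F} (ha : ∀ i, a i ≠ 0) {s : ℕ} (hs : s ≤ n) :
    EigenGap (semimonomialMap σ π a) s := by
  intro E l hE
  obtain ⟨c, hc⟩ : ∃ c, σ c ≠ c := by
    by_contra hcon
    push Not at hcon
    exact hσ (RingEquiv.ext hcon)
  have : E = ⊥ := by
    rw [Submodule.eq_bot_iff]
    intro x hx
    have h1 := hE _ (E.smul_mem c hx)
    rw [map_smulₛₗ, hE x hx, smul_smul, smul_smul, ← sub_eq_zero, ← sub_smul] at h1
    rcases smul_eq_zero.1 h1 with h2 | h2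
    · have h3 : l * (σ c - c) = 0 := by
        have : σ c * l - l * c = 0 := h2
        linear_combination this
      have h4 := (mul_eq_zero.1 h3).resolve_right (sub_ne_zero.2 hc)
      have h5 := hE x hx
      rw [h4, zero_smul] at h5
      exact (injective_iff_map_eq_zero _).1 (semimonomialMap_injective σ π ha) x h5
    · exact h2
  rw [this, finrank_bot, Module.finrank_fintype_fun_eq_card, Fintype.card_fin]
  omega

/-- A non-scalar semimonomial map has few invariant subspaces, in terms of the number of
coordinates on which it differs from a suitable scalar. -/
theorem card_invSubspaces_semimonomialMap_le [Fintype F] [DecidableEq F] {m : ℕ} (hm : 96 ≤ m)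
    (σ : F ≃+* F) (π : Equiv.Perm (Fin (2 * m))) {a : Fin (2 * m) → F} (ha : ∀ i, a i ≠ 0)
    (hns : ¬ (σ = RingEquiv.refl F ∧ ∃ l, ∀ i, π i = i ∧ a i = l)) {k : ℕ} (hk : k ≤ 2 * m) :
    ∃ l : F, (displaced l fun i => (π i, a i)).Nonempty ∧
      Nat.card (invSubspaces (semimonomialMap σ π a) k) *
        Fintype.card F ^ (m / 96 * (displaced l fun i => (π i, a i)).card) ≤
      (8 * Fintype.card F ^ 2) ^ ((displaced l fun i => (π i, a i)).card + 1) *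
        Fintype.card F ^ (m * m) := by
  have hq : 2 ≤ Fintype.card F := Fintype.one_lt_card
  have hdim : Module.finrank F (Fin (2 * m) → F) = 2 * m := by simp
  have key : ∃ l : F, (displaced l fun i => (π i, a i)).Nonempty ∧
      EigenGap (semimonomialMap σ π a) (((displaced l fun i => (π i, a i)).card + 11) / 12) := by
    by_cases hσ : σ = RingEquiv.refl F
    · subst hσ
      obtain ⟨l, -, hl⟩ := Finset.exists_min_image (Finset.univ : Finset F)
        (fun l => (displaced l fun i => (π i, a i)).card) ⟨0, Finset.mem_univ _⟩
      refine ⟨l, ?_, eigenGap_semimonomialMap_refl π ha fun l' => ?_⟩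
      · rw [Finset.nonempty_iff_ne_empty]
        intro h
        refine hns ⟨rfl, l, fun i => ?_⟩
        have : i ∉ displaced l fun i => (π i, a i) := by rw [h]; simp
        simpa [displaced] using this
      · have := hl l' (Finset.mem_univ _)
        omega
    · have hall : displaced 0 (fun i => (π i, a i)) = Finset.univ := by
        ext i; simp [displaced, ha]
      refine ⟨0, ?_, eigenGap_semimonomialMap_of_ne hσ π ha ?_⟩
      · rw [hall]
        exact ⟨⟨0, by omega⟩, Finset.mem_univ _⟩
      · rw [hall, Finset.card_univ, Fintype.card_fin]
        omega
  obtain ⟨l, hne, hgap⟩ := key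
  refine ⟨l, hne, ?_⟩
  obtain ⟨d, hd⟩ : ∃ d, (displaced l fun i => (π i, a i)).card = d := ⟨_, rfl⟩
  have hd1 : d ≤ 2 * m := by
    have := Finset.card_le_univ (displaced l fun i => (π i, a i))
    rw [Fintype.card_fin] at this
    omega
  have hd0 : 0 < d := hd ▸ hne.card_pos
  rw [hd] at hgap ⊢
  obtain ⟨b, hb⟩ := Nat.exists_eq_add_of_le hk
  have hη : 96 * (m / 96) ≤ m := Nat.mul_div_le m 96
  have hη1 : 1 ≤ m / 96 := (Nat.one_le_div_iff (by norm_num)).2 hm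
  set η := m / 96
  set q := Fintype.card F
  have hK1 : 1 ≤ 8 * q ^ 2 := by nlinarith
  by_cases hmid : m ≤ 2 * k ∧ m ≤ 2 * b
  · have hmain := card_invSubspaces_mul_le _ (semimonomialMap_injective σ π ha) hgap
      (k := k) (b := b) (δ := 12 * η) (by rw [hdim, hb]) (by omega) (by omega) (by omega)
    have hkb : k * b ≤ m * m := by
      zify at hb ⊢
      nlinarith [sq_nonneg ((k : ℤ) - b)]
    have he : η * d ≤ (d + 11) / 12 * (12 * η) := by
      have : d ≤ 12 * ((d + 11) / 12) := by omega
      nlinarith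
    calc _ ≤ Nat.card (invSubspaces (semimonomialMap σ π a) k) * q ^ ((d + 11) / 12 * (12 * η)) := by
          gcongr; omega
      _ ≤ _ := hmain
      _ ≤ _ := by
          gcongr <;> omega
  · have hmain := card_invSubspaces_le (semimonomialMap σ π a) (k := k) (b := b)
      (by rw [hdim, hb])
    have hkb : k * b + η * d ≤ m * m := by
      have h1 : 4 * (k * b) ≤ 3 * (m * m) := by
        rw [not_and_or, not_le, not_le] at hmid
        zify at hb hmid ⊢
        rcases hmid with h | h
        · nlinarith
        · nlinarith
      have h2 : η * d * 4 ≤ m * m := by nlinarith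
      omega
    calc _ ≤ 4 * q ^ (k * b) * q ^ (η * d) := Nat.mul_le_mul_right _ hmain
      _ = 4 * q ^ (k * b + η * d) := by rw [mul_assoc, ← pow_add]
      _ ≤ _ := by
        have h4 : 4 ≤ (8 * q ^ 2) ^ (d + 1) :=
          le_trans (by nlinarith) (Nat.le_self_pow (by omega) (8 * q ^ 2))
        gcongr
        omega

theorem sum_displaced_nonempty_le [Fintype F] [DecidableEq F] (l : F) {y : ℝ} (hy : 0 ≤ y) :
    ∑ φ : Fin n → Fin n × F with (displaced l φ).Nonempty, y ^ (displaced l φ).card ≤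
      (1 + n * Fintype.card F * y) ^ n - 1 := by
  classical
  have h1 := sum_pow_card_displaced (n := n) l y
  rw [← Finset.sum_filter_add_sum_filter_not Finset.univ
    (fun φ : Fin n → Fin n × F => (displaced l φ).Nonempty)] at h1
  have h2 : (1 : ℝ) ≤ ∑ φ : Fin n → Fin n × F with ¬ (displaced l φ).Nonempty,
      y ^ (displaced l φ).card := by
    have h3 : displaced l (fun i : Fin n => (i, l)) = ∅ := by simp [displaced]
    have := Finset.single_le_sum
      (s := Finset.univ.filter fun φ : Fin n → Fin n × F => ¬ (displaced l φ).Nonempty)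
      (f := fun φ => y ^ (displaced l φ).card) (fun _ _ => by positivity)
      (a := fun i => (i, l)) (by simp [h3])
    simpa [h3] using this
  have h4 : (1 + ((n : ℝ) * Fintype.card F - 1) * y) ^ n ≤ (1 + n * Fintype.card F * y) ^ n := by
    rcases Nat.eq_zero_or_pos n with rfl | hn
    · simp
    have h5 : (1 : ℝ) ≤ n * Fintype.card F := by
      exact_mod_cast Nat.mul_pos hn Fintype.card_pos
    have h6 : 0 ≤ ((n : ℝ) * Fintype.card F - 1) * y := mul_nonneg (by linarith) hy
    gcongr
    linarith
  linarith

theorem sum_le_of_displaced [Fintype F] [DecidableEq F] {ι : Type*} (S : Finset ι) (c : ι → ℝ)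
    (p : ι → (F ≃+* F) × (Fin n → Fin n × F)) (hp : Set.InjOn p S) {C y : ℝ} (hC : 0 ≤ C)
    (hy : 0 ≤ y)
    (h : ∀ i ∈ S, ∃ l, (displaced l (p i).2).Nonempty ∧ c i ≤ C * y ^ (displaced l (p i).2).card) :
    ∑ i ∈ S, c i ≤ C * (Nat.card (F ≃+* F) * (Fintype.card F *
      ((1 + n * Fintype.card F * y) ^ n - 1))) := by
  classical
  have hfin : Finite (F ≃+* F) := Finite.of_injective (fun f : F ≃+* F => (f : F → F))
    DFunLike.coe_injective
  have : Fintype (F ≃+* F) := Fintype.ofFinite _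
  let w : (F ≃+* F) × (Fin n → Fin n × F) → ℝ := fun x =>
    ∑ l : F, if (displaced l x.2).Nonempty then y ^ (displaced l x.2).card else 0
  have hw0 : ∀ x, 0 ≤ w x := fun x => Finset.sum_nonneg fun l _ => by
    split_ifs <;> positivity
  have hw : ∀ i ∈ S, c i ≤ C * w (p i) := by
    intro i hi
    obtain ⟨l, hl, hle⟩ := h i hi
    refine hle.trans (mul_le_mul_of_nonneg_left ?_ hC)
    have := Finset.single_le_sum (s := (Finset.univ : Finset F))
      (f := fun l => if (displaced l (p i).2).Nonempty then y ^ (displaced l (p i).2).card else 0)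
      (fun l _ => by split_ifs <;> positivity) (Finset.mem_univ l)
    simpa [hl] using this
  calc ∑ i ∈ S, c i ≤ ∑ i ∈ S, C * w (p i) := Finset.sum_le_sum hw
    _ = C * ∑ x ∈ S.image p, w x := by rw [Finset.sum_image hp, Finset.mul_sum]
    _ ≤ C * ∑ x, w x := by
        refine mul_le_mul_of_nonneg_left ?_ hC
        exact Finset.sum_le_sum_of_subset_of_nonneg (Finset.subset_univ _) fun x _ _ => hw0 x
    _ ≤ _ := by
        refine mul_le_mul_of_nonneg_left ?_ hC
        rw [Fintype.sum_prod_type]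
        simp only [w]
        rw [Finset.sum_const, nsmul_eq_mul, Finset.card_univ, Nat.card_eq_fintype_card]
        refine mul_le_mul_of_nonneg_left ?_ (by positivity)
        rw [Finset.sum_comm]
        calc _ ≤ ∑ _l : F, ((1 + (n : ℝ) * Fintype.card F * y) ^ n - 1) := by
              refine Finset.sum_le_sum fun l _ => ?_
              rw [← Finset.sum_filter]
              exact sum_displaced_nonempty_le l hy
          _ = _ := by rw [Finset.sum_const, nsmul_eq_mul, Finset.card_univ]

end SemimonomialMaps

section SemimonomialGroup

variable (F : Type) [Field F] (n : ℕ)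

/-- The parameters allowed for the group of semimonomial maps whose diagonal part is arbitrary
if `d` holds and trivial otherwise, and whose field automorphism is arbitrary if `s` holds and
trivial otherwise. -/
def SemimonomialParams (d s : Prop) (σ : F ≃+* F) (a : Fin n → F) : Prop :=
  (∀ i, a i ≠ 0) ∧ (s ∨ σ = RingEquiv.refl F) ∧ (d ∨ ∀ i, a i = 1)

/-- The group of permutations of `F ^ n` given by semimonomial maps with parameters restricted
by `SemimonomialParams F n d s`. -/
def semimonomialGroup (d s : Prop) : Subgroup (Equiv.Perm (Fin n → F)) where
  carrier := {f | ∃ (σ : F ≃+* F) (π : Equiv.Perm (Fin n)) (a : Fin n → F),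
    SemimonomialParams F n d s σ a ∧ ∀ x, f x = semimonomialMap σ π a x}
  one_mem' := ⟨RingEquiv.refl F, 1, fun _ => 1,
    ⟨fun _ => one_ne_zero, Or.inr rfl, Or.inr fun _ => rfl⟩, fun x => by
      ext i; rw [semimonomialMap_apply]; simp⟩
  mul_mem' := by
    rintro f g ⟨σ, π, a, ⟨ha, hσ, hd⟩, hf⟩ ⟨τ, ρ, b, ⟨hb, hτ, hd'⟩, hg⟩
    refine ⟨τ.trans σ, ρ * π, fun i => a i * σ (b (π i)), ⟨fun i => ?_, ?_, ?_⟩, fun x => ?_⟩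
    · simp [ha, hb]
    · rcases hσ with h | h
      · exact Or.inl h
      rcases hτ with h' | h'
      · exact Or.inl h'
      · right; subst h h'; rfl
    · rcases hd with h | h
      · exact Or.inl h
      rcases hd' with h' | h'
      · exact Or.inl h'
      · right; simp [h, h']
    · ext i
      rw [semimonomialMap_apply]
      simp [hf, hg, mul_assoc]
  inv_mem' := by
    rintro f ⟨σ, π, a, ⟨ha, hσ, hd⟩, hf⟩
    refine ⟨σ.symm, π⁻¹, fun i => σ.symm (a (π⁻¹ i))⁻¹, ⟨fun i => ?_, ?_, ?_⟩, fun x => ?_⟩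
    · simp [ha]
    · rcases hσ with h | h
      · exact Or.inl h
      · right; subst h; rfl
    · rcases hd with h | h
      · exact Or.inl h
      · right; simp [h]
    · rw [Equiv.Perm.inv_eq_iff_eq]
      ext i
      simp [hf, ha]

variable {F n}

/-- Orbit relation of `semimonomialGroup F n d s` on subspaces. -/
def semimonomialRel (d s : Prop) (V W : Submodule F (Fin n → F)) : Prop :=
  ∃ (σ : F ≃+* F) (π : Equiv.Perm (Fin n)) (a : Fin n → F), SemimonomialParams F n d s σ a ∧
    (W : Set (Fin n → F)) = semimonomialMap σ π a '' V

instance (d s : Prop) : MulAction (semimonomialGroup F n d s) (Submodule F (Fin n → F)) where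
  smul g W :=
    { carrier := g.1 '' W
      add_mem' := by
        obtain ⟨g, σ, π, a, -, hg⟩ := g
        rintro _ _ ⟨x, hx, rfl⟩ ⟨y, hy, rfl⟩
        exact ⟨x + y, W.add_mem hx hy, by simp only [hg, map_add]⟩
      zero_mem' := by
        obtain ⟨g, σ, π, a, -, hg⟩ := g
        exact ⟨0, W.zero_mem, by simp only [hg, map_zero]⟩
      smul_mem' := by
        obtain ⟨g, σ, π, a, -, hg⟩ := g
        rintro c _ ⟨x, hx, rfl⟩
        exact ⟨σ.symm c • x, W.smul_mem _ hx, by simp only [hg, map_smulₛₗ]; simp⟩ }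
  one_smul W := SetLike.coe_injective (Set.image_id (W : Set (Fin n → F)))
  mul_smul g h W := SetLike.coe_injective (Set.image_comp g.1 h.1 (W : Set (Fin n → F)))

theorem semimonomialRel_iff {d s : Prop} (V W : Submodule F (Fin n → F)) :
    semimonomialRel d s V W ↔ ∃ g : semimonomialGroup F n d s, g • V = W := by
  constructor
  · rintro ⟨σ, π, a, h, hW⟩
    have hinj := semimonomialMap_injective σ π h.1
    have hsurj : Function.Surjective (semimonomialMap σ π a) := by
      intro y
      refine ⟨fun i => σ.symm ((a (π.symm i))⁻¹ * y (π.symm i)), ?_⟩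
      ext i
      simp [h.1]
    exact ⟨⟨Equiv.ofBijective _ ⟨hinj, hsurj⟩, σ, π, a, h, fun _ => rfl⟩,
      SetLike.coe_injective hW.symm⟩
  · rintro ⟨⟨g, σ, π, a, h, hg⟩, rfl⟩
    exact ⟨σ, π, a, h, Set.image_congr' hg⟩

theorem finrank_semimonomialGroup_smul [Fintype F] {d s : Prop} (g : semimonomialGroup F n d s)
    (W : Submodule F (Fin n → F)) :
    Module.finrank F (g • W : Submodule F (Fin n → F)) = Module.finrank F W := by
  have h : Nat.card (g • W : Submodule F (Fin n → F)) = Nat.card W :=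
    Nat.card_image_of_injective g.1.injective (W : Set (Fin n → F))
  rw [Module.natCard_eq_pow_finrank (K := F), Module.natCard_eq_pow_finrank (K := F) (V := W)] at h
  refine Nat.pow_right_injective ?_ h
  rw [Nat.card_eq_fintype_card]
  exact Fintype.one_lt_card

instance [Fintype F] (d s : Prop) (k : ℕ) : MulAction (semimonomialGroup F n d s)
    {W : Submodule F (Fin n → F) // Module.finrank F W = k} where
  smul g W := ⟨g • W.1, (finrank_semimonomialGroup_smul g W.1).trans W.2⟩
  one_smul W := Subtype.ext (one_smul _ W.1)
  mul_smul g h W := Subtype.ext (mul_smul g h W.1)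

/-- Burnside's lemma with the contribution of trivially acting elements separated. -/
theorem card_quot_mul_card_eq {G X : Type*} [Group G] [Fintype G] [MulAction G X] [Finite X]
    (r : X → X → Prop) (hr : ∀ x y, r x y ↔ ∃ g : G, g • x = y) (Z : Finset G)
    (hZ : ∀ g ∈ Z, ∀ x : X, g • x = x) [DecidableEq G] :
    Nat.card (Quot r) * Nat.card G =
      Nat.card X * Z.card + ∑ g ∈ Zᶜ, Nat.card (MulAction.fixedBy X g) := by
  classical
  have := Fintype.ofFinite X
  have := fun g : G => Fintype.ofFinite (MulAction.fixedBy X g)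
  have := Fintype.ofFinite (Quotient (MulAction.orbitRel G X))
  have h1 := MulAction.sum_card_fixedBy_eq_card_orbits_mul_card_group G X
  have h2 : Nat.card (Quot r) = Nat.card (Quotient (MulAction.orbitRel G X)) := by
    refine Nat.card_congr (Quot.congrRight fun x y => ?_)
    rw [hr, MulAction.orbitRel_apply, MulAction.mem_orbit_iff]
    constructor
    · rintro ⟨g, rfl⟩
      exact ⟨g⁻¹, by simp⟩
    · rintro ⟨g, rfl⟩
      exact ⟨g⁻¹, by simp⟩
  rw [h2, Nat.card_eq_fintype_card, Nat.card_eq_fintype_card (α := G), ← h1,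
    ← Finset.sum_add_sum_compl Z]
  congr 1
  · rw [mul_comm, ← smul_eq_mul, ← Finset.sum_const]
    refine Finset.sum_congr rfl fun g hg => ?_
    rw [← Nat.card_eq_fintype_card]
    exact Nat.card_congr (Equiv.subtypeUnivEquiv (hZ g hg))
  · simp only [Nat.card_eq_fintype_card]

end SemimonomialGroup

section OrbitCounts

variable {F : Type} [Field F] [Fintype F]

/-- Number of orbits on `k`-dimensional subspaces of the group of semimonomial maps. -/
noncomputable def orbitCountDim (F : Type) [Field F] (n : ℕ) (d s : Prop) (k : ℕ) : ℕ :=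
  Nat.card (Quot fun V W : {V : Submodule F (Fin n → F) // Module.finrank F V = k} =>
    semimonomialRel d s V.1 W.1)

/-- Number of orbits on all subspaces of the group of semimonomial maps. -/
noncomputable def orbitCount (F : Type) [Field F] (n : ℕ) (d s : Prop) : ℕ :=
  Nat.card (Quot fun V W : Submodule F (Fin n → F) => semimonomialRel d s V W)

theorem semimonomialRel_subtype_iff {n k : ℕ} {d s : Prop}
    (V W : {V : Submodule F (Fin n → F) // Module.finrank F V = k}) :
    semimonomialRel d s V.1 W.1 ↔ ∃ g : semimonomialGroup F n d s, g • V = W := by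
  rw [semimonomialRel_iff]
  exact exists_congr fun g => ⟨fun h => Subtype.ext h, fun h => congrArg Subtype.val h⟩

theorem card_submodule_eq_sum {n : ℕ} (P : Submodule F (Fin n → F) → Prop) :
    Nat.card {W // P W} = ∑ k ∈ Finset.range (n + 1),
      Nat.card {W : {W : Submodule F (Fin n → F) // Module.finrank F W = k} // P W.1} := by
  classical
  have := Fintype.ofFinite (Submodule F (Fin n → F))
  rw [Nat.card_eq_fintype_card, Fintype.card_subtype,
    Finset.card_eq_sum_card_fiberwise (f := fun W : Submodule F (Fin n → F) => Module.finrank F W)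
      (t := Finset.range (n + 1))]
  · refine Finset.sum_congr rfl fun k _ => ?_
    rw [Finset.filter_filter, ← Fintype.card_subtype, ← Nat.card_eq_fintype_card]
    refine Nat.card_congr ((Equiv.subtypeEquivRight fun W => and_comm).trans
      (Equiv.subtypeSubtypeEquivSubtypeInter _ P).symm)
  · intro W _
    have := Submodule.finrank_le W
    rw [Module.finrank_fintype_fun_eq_card, Fintype.card_fin] at this
    simp only [Finset.coe_range, Set.mem_Iio]
    omega

theorem orbitCount_eq_sum (n : ℕ) (d s : Prop) :
    orbitCount F n d s = ∑ k ∈ Finset.range (n + 1), orbitCountDim F n d s k := by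
  classical
  have := Fintype.ofFinite (semimonomialGroup F n d s)
  have hG : 0 < Nat.card (semimonomialGroup F n d s) := Nat.card_pos
  have h1 := card_quot_mul_card_eq (G := semimonomialGroup F n d s) (semimonomialRel d s)
    semimonomialRel_iff ∅ (by simp)
  have h2 := fun k => card_quot_mul_card_eq (G := semimonomialGroup F n d s) _
    (semimonomialRel_subtype_iff (n := n) (k := k) (d := d) (s := s)) ∅ (by simp)
  refine Nat.eq_of_mul_eq_mul_right hG ?_
  rw [Finset.sum_mul, orbitCount, h1]
  simp only [orbitCountDim, h2, Finset.card_empty, mul_zero, zero_add]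
  rw [Finset.sum_comm]
  refine Finset.sum_congr rfl fun g _ => (card_submodule_eq_sum fun W => g • W = W).trans ?_
  refine Finset.sum_congr rfl fun k _ => Nat.card_congr ?_
  exact Equiv.subtypeEquivRight fun W =>
    ⟨fun h => Subtype.ext h, fun h => congrArg Subtype.val h⟩

/-- Upper bound for the total number of fixed subspaces, of any given dimension, of the
non-scalar semimonomial maps of `F ^ (2 * m)`. -/
noncomputable def orbitError (F : Type) [Field F] [Fintype F] (m : ℕ) : ℝ :=
  8 * (Fintype.card F : ℝ) ^ 2 * (Fintype.card F : ℝ) ^ (m * m) *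
    (Nat.card (F ≃+* F) * (Fintype.card F * ((1 + (2 * m : ℕ) * Fintype.card F *
      (8 * (Fintype.card F : ℝ) ^ 2 / (Fintype.card F : ℝ) ^ (m / 96))) ^ (2 * m) - 1)))

theorem exists_abs_mul_orbitCountDim_sub_le {m : ℕ} (hm : 96 ≤ m) (d s : Prop) :
    ∃ c : ℝ, 0 < c ∧ ∀ k ≤ 2 * m, |c * orbitCountDim F (2 * m) d s k -
      Nat.card {W : Submodule F (Fin (2 * m) → F) // Module.finrank F W = k}| ≤
        orbitError F m := by
  classical
  let G := semimonomialGroup F (2 * m) d s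
  have := Fintype.ofFinite G
  let Z : Finset G := Finset.univ.filter fun g => ∀ W : Submodule F (Fin (2 * m) → F), g • W = W
  have hZ : ∀ g, g ∈ Z ↔ ∀ W : Submodule F (Fin (2 * m) → F), g • W = W := by simp [Z]
  have hz : 0 < Z.card := Finset.card_pos.2 ⟨1, (hZ 1).2 fun W => one_smul G W⟩
  have hz1 : (1 : ℝ) ≤ Z.card := by exact_mod_cast hz
  have hG : 0 < Nat.card G := Nat.card_pos
  choose σ π a h hg using fun g : G => g.2
  have hns : ∀ g ∈ Zᶜ, ¬ (σ g = RingEquiv.refl F ∧ ∃ l, ∀ i, π g i = i ∧ a g i = l) := by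
    rintro g hgZ ⟨hσ, l, hl⟩
    rw [Finset.mem_compl, hZ] at hgZ
    refine hgZ fun W => ?_
    refine Submodule.eq_of_le_of_finrank_eq ?_ (finrank_semimonomialGroup_smul g W)
    rintro _ ⟨x, hx, rfl⟩
    have : g.1 x = l • x := by
      rw [hg g x]
      ext i
      rw [semimonomialMap_apply, hσ, (hl i).1, (hl i).2]
      rfl
    rw [this]
    exact W.smul_mem l hx
  refine ⟨Nat.card G / Z.card, by positivity, fun k hk => ?_⟩
  have hB := card_quot_mul_card_eq (G := G) _
    (semimonomialRel_subtype_iff (n := 2 * m) (k := k) (d := d) (s := s)) Z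
    (fun g hgZ W => Subtype.ext ((hZ g).1 hgZ W.1))
  have hsum : ∑ g ∈ Zᶜ, (Nat.card (MulAction.fixedBy
      {W : Submodule F (Fin (2 * m) → F) // Module.finrank F W = k} g) : ℝ) ≤ orbitError F m := by
    refine sum_le_of_displaced Zᶜ _ (fun g => (σ g, fun i => (π g i, a g i))) ?_ (by positivity)
      (by positivity) fun g hgZ => ?_
    · intro f _ g _ hfg
      rw [Prod.mk.injEq] at hfg
      refine Subtype.ext (Equiv.ext fun x => ?_)
      rw [hg f x, hg g x]
      ext i
      have := congrFun hfg.2 i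
      rw [Prod.mk.injEq] at this
      rw [semimonomialMap_apply, semimonomialMap_apply, hfg.1, this.1, this.2]
    · obtain ⟨l, hl, hle⟩ := card_invSubspaces_semimonomialMap_le hm (σ g) (π g) (h g).1
        (hns g hgZ) hk
      refine ⟨l, hl, ?_⟩
      have hfix : Nat.card (MulAction.fixedBy
          {W : Submodule F (Fin (2 * m) → F) // Module.finrank F W = k} g) ≤
          Nat.card (invSubspaces (semimonomialMap (σ g) (π g) (a g)) k) := by
        refine Nat.card_le_card_of_injective (fun W => ⟨W.1.1, W.1.2, fun w hw => ?_⟩) ?_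
        · have h1 : g • W.1.1 = W.1.1 := congrArg Subtype.val W.2
          rw [← hg g w, ← h1]
          exact ⟨w, hw, rfl⟩
        · intro V W hVW
          have h1 : V.1.1 = W.1.1 := Subtype.mk.inj hVW
          exact Subtype.ext (Subtype.ext h1)
      have hle' : (Nat.card (MulAction.fixedBy
          {W : Submodule F (Fin (2 * m) → F) // Module.finrank F W = k} g) : ℝ) *
          (Fintype.card F : ℝ) ^ (m / 96 * (displaced l fun i => (π g i, a g i)).card) ≤
          (8 * (Fintype.card F : ℝ) ^ 2) ^ ((displaced l fun i => (π g i, a g i)).card + 1) *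
            (Fintype.card F : ℝ) ^ (m * m) := by
        exact_mod_cast (Nat.mul_le_mul_right _ hfix).trans hle
      have hq : (0 : ℝ) < Fintype.card F := by exact_mod_cast Fintype.card_pos
      rw [div_pow, ← pow_mul, mul_div_assoc', le_div_iff₀ (by positivity)]
      refine hle'.trans (le_of_eq ?_)
      ring
  have hB' : (orbitCountDim F (2 * m) d s k : ℝ) * Nat.card G =
      Nat.card {W : Submodule F (Fin (2 * m) → F) // Module.finrank F W = k} * Z.card +
      ∑ g ∈ Zᶜ, (Nat.card (MulAction.fixedBy
      {W : Submodule F (Fin (2 * m) → F) // Module.finrank F W = k} g) : ℝ) := by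
    exact_mod_cast hB
  have h0 : 0 ≤ ∑ g ∈ Zᶜ, (Nat.card (MulAction.fixedBy
      {W : Submodule F (Fin (2 * m) → F) // Module.finrank F W = k} g) : ℝ) :=
    Finset.sum_nonneg fun _ _ => by positivity
  have heq : (Nat.card G / Z.card : ℝ) * orbitCountDim F (2 * m) d s k -
      Nat.card {W : Submodule F (Fin (2 * m) → F) // Module.finrank F W = k} =
      (∑ g ∈ Zᶜ, (Nat.card (MulAction.fixedBy
      {W : Submodule F (Fin (2 * m) → F) // Module.finrank F W = k} g) : ℝ)) / Z.card := by
    rw [eq_div_iff (by positivity), sub_mul, div_mul_eq_mul_div, div_mul_cancel₀ _ (by positivity)]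
    linarith
  rw [heq, abs_of_nonneg (by positivity)]
  exact (div_le_self h0 hz1).trans hsum

end OrbitCounts

section OrbitRelations

variable {F : Type} [Field F] {n : ℕ}

theorem permMatrix_mulVec_eq (π : Equiv.Perm (Fin n)) (x : Fin n → F) :
    (π.permMatrix F) *ᵥ x = semimonomialMap (RingEquiv.refl F) π (fun _ => 1) x := by
  ext i
  rw [semimonomialMap_apply]
  simp [Matrix.permMatrix_mulVec]

theorem diagonal_mulVec_eq (a x : Fin n → F) :
    Matrix.diagonal a *ᵥ x = semimonomialMap (RingEquiv.refl F) 1 a x := by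
  ext i
  rw [semimonomialMap_apply]
  simp [Matrix.mulVec_diagonal]

/-- The permutation of `F ^ n` induced by an invertible matrix. -/
def mulVecPerm (F : Type) [Field F] (n : ℕ) :
    GL (Fin n) F →* Equiv.Perm (Fin n → F) where
  toFun M :=
    { toFun := fun x => (M : Matrix (Fin n) (Fin n) F) *ᵥ x
      invFun := fun x => ((M⁻¹ : GL (Fin n) F) : Matrix (Fin n) (Fin n) F) *ᵥ x
      left_inv := fun x => by beta_reduce; rw [Matrix.mulVec_mulVec, ← Units.val_mul]; simp
      right_inv := fun x => by beta_reduce; rw [Matrix.mulVec_mulVec, ← Units.val_mul]; simp }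
  map_one' := by ext1 x; simp
  map_mul' M N := by ext1 x; simp [Matrix.mulVec_mulVec]

theorem mulVecPerm_apply (M : GL (Fin n) F) (x : Fin n → F) :
    mulVecPerm F n M x = (M : Matrix (Fin n) (Fin n) F) *ᵥ x := rfl

theorem mulVecPerm_mem_of_mem_permGroup {M : GL (Fin n) F} (hM : M ∈ PermGroup F n) :
    mulVecPerm F n M ∈ semimonomialGroup F n False False := by
  have : PermGroup F n ≤ (semimonomialGroup F n False False).comap (mulVecPerm F n) := by
    rw [PermGroup, Subgroup.closure_le]
    rintro M ⟨π, hπ⟩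
    exact ⟨_, π, _, ⟨fun _ => one_ne_zero, Or.inr rfl, Or.inr fun _ => rfl⟩, fun x => by
      rw [mulVecPerm_apply, hπ, permMatrix_mulVec_eq]⟩
  exact this hM

theorem mulVecPerm_mem_of_mem_monomialGroup {M : GL (Fin n) F} (hM : M ∈ MonomialGroup F n) :
    mulVecPerm F n M ∈ semimonomialGroup F n True False := by
  have : MonomialGroup F n ≤ (semimonomialGroup F n True False).comap (mulVecPerm F n) := by
    rw [MonomialGroup, Subgroup.closure_le]
    rintro M (⟨π, hπ⟩ | ⟨a, ha⟩)
    · exact ⟨_, π, _, ⟨fun _ => one_ne_zero, Or.inr rfl, Or.inl trivial⟩, fun x => by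
        rw [mulVecPerm_apply, hπ, permMatrix_mulVec_eq]⟩
    · refine ⟨_, 1, a, ⟨fun i => ?_, Or.inr rfl, Or.inl trivial⟩, fun x => by
        rw [mulVecPerm_apply, ha, diagonal_mulVec_eq]⟩
      have h1 := (Matrix.isUnit_iff_isUnit_det _).1 M.isUnit
      rw [ha, Matrix.det_diagonal, isUnit_iff_ne_zero, Finset.prod_ne_zero_iff] at h1
      exact h1 i (Finset.mem_univ i)
  exact this hM

theorem exists_mem_permSet (π : Equiv.Perm (Fin n)) :
    ∃ M ∈ permSet F n, (M : Matrix (Fin n) (Fin n) F) = π.permMatrix F := by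
  have h : IsUnit (π.permMatrix F) := by
    rw [Matrix.isUnit_iff_isUnit_det, Matrix.det_permutation]
    exact ((Equiv.Perm.sign π).isUnit).map (Int.castRingHom F)
  obtain ⟨M, hM⟩ := h
  exact ⟨M, ⟨π, hM⟩, hM⟩

theorem exists_mem_diagSet {a : Fin n → F} (ha : ∀ i, a i ≠ 0) :
    ∃ M ∈ diagSet F n, (M : Matrix (Fin n) (Fin n) F) = Matrix.diagonal a := by
  have h : IsUnit (Matrix.diagonal a) := by
    rw [Matrix.isUnit_iff_isUnit_det, Matrix.det_diagonal, isUnit_iff_ne_zero,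
      Finset.prod_ne_zero_iff]
    exact fun i _ => ha i
  obtain ⟨M, hM⟩ := h
  exact ⟨M, ⟨a, hM⟩, hM⟩

theorem exists_mem_monomialGroup (π : Equiv.Perm (Fin n)) {a : Fin n → F} (ha : ∀ i, a i ≠ 0) :
    ∃ M ∈ MonomialGroup F n, ∀ x i, ((M : Matrix (Fin n) (Fin n) F) *ᵥ x) i = a i * x (π i) := by
  obtain ⟨M, hM, hMπ⟩ := exists_mem_permSet (F := F) π
  obtain ⟨D, hD, hDa⟩ := exists_mem_diagSet ha
  refine ⟨D * M, mul_mem (Subgroup.subset_closure (Or.inr hD))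
    (Subgroup.subset_closure (Or.inl hM)), fun x i => ?_⟩
  rw [Units.val_mul, ← Matrix.mulVec_mulVec, hMπ, hDa, permMatrix_mulVec_eq, Matrix.mulVec_diagonal,
    semimonomialMap_apply]
  simp

theorem permGroup_rel_iff (V W : Submodule F (Fin n → F)) :
    (∃ M ∈ PermGroup F n, Submodule.map (Matrix.toLin' (M : Matrix (Fin n) (Fin n) F)) V = W) ↔
      semimonomialRel False False V W := by
  constructor
  · rintro ⟨M, hM, rfl⟩
    obtain ⟨σ, π, a, h, hf⟩ := mulVecPerm_mem_of_mem_permGroup hM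
    exact ⟨σ, π, a, h, Set.image_congr' hf⟩
  · rintro ⟨σ, π, a, ⟨-, hσ, ha⟩, hW⟩
    obtain ⟨M, hM, hMπ⟩ := exists_mem_permSet (F := F) π
    refine ⟨M, Subgroup.subset_closure hM, SetLike.coe_injective ?_⟩
    rw [hW]
    refine Set.image_congr' fun x => ?_
    obtain rfl := hσ.resolve_left id
    obtain rfl : a = fun _ => 1 := funext (ha.resolve_left id)
    rw [Matrix.toLin'_apply, hMπ, permMatrix_mulVec_eq]

theorem monomialGroup_rel_iff (V W : Submodule F (Fin n → F)) :
    (∃ M ∈ MonomialGroup F n, Submodule.map (Matrix.toLin' (M : Matrix (Fin n) (Fin n) F)) V = W) ↔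
      semimonomialRel True False V W := by
  constructor
  · rintro ⟨M, hM, rfl⟩
    obtain ⟨σ, π, a, h, hf⟩ := mulVecPerm_mem_of_mem_monomialGroup hM
    exact ⟨σ, π, a, h, Set.image_congr' hf⟩
  · rintro ⟨σ, π, a, ⟨ha, hσ, -⟩, hW⟩
    obtain ⟨M, hM, hMπ⟩ := exists_mem_monomialGroup π ha
    refine ⟨M, hM, SetLike.coe_injective ?_⟩
    rw [hW]
    refine Set.image_congr' fun x => ?_
    obtain rfl := hσ.resolve_left id
    exact funext fun i => hMπ x i

theorem semiRel_iff (V W : Submodule F (Fin n → F)) :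
    semiRel F n V W ↔ semimonomialRel True True V W := by
  constructor
  · rintro ⟨τ, M, hM, hW⟩
    obtain ⟨σ, π, a, h, hf⟩ := mulVecPerm_mem_of_mem_monomialGroup hM
    refine ⟨τ, π, a, ⟨h.1, Or.inl trivial, Or.inl trivial⟩, hW.trans ?_⟩
    refine Set.image_congr' fun x => ?_
    obtain rfl := h.2.1.resolve_left id
    exact hf _
  · rintro ⟨σ, π, a, ⟨ha, -, -⟩, hW⟩
    obtain ⟨M, hM, hMπ⟩ := exists_mem_monomialGroup π ha
    refine ⟨σ, M, hM, hW.trans (Set.image_congr' fun x => ?_)⟩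
    exact funext fun i => (hMπ (fun j => σ (x j)) i).symm

theorem numClasses_permGroup : numClasses F (PermGroup F n) = orbitCount F n False False := by
  simp only [numClasses, orbitCount, permGroup_rel_iff]

theorem numClassesDim_permGroup (k : ℕ) :
    numClassesDim F (PermGroup F n) k = orbitCountDim F n False False k := by
  simp only [numClassesDim, orbitCountDim, permGroup_rel_iff]

theorem numClasses_monomialGroup :
    numClasses F (MonomialGroup F n) = orbitCount F n True False := by
  simp only [numClasses, orbitCount, monomialGroup_rel_iff]

theorem numClassesDim_monomialGroup (k : ℕ) :
    numClassesDim F (MonomialGroup F n) k = orbitCountDim F n True False k := by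
  simp only [numClassesDim, orbitCountDim, monomialGroup_rel_iff]

theorem numClassesSemi_eq : numClassesSemi F n = orbitCount F n True True := by
  simp only [numClassesSemi, orbitCount, semiRel_iff]

theorem numClassesDimSemi_eq (k : ℕ) :
    numClassesDimSemi F n k = orbitCountDim F n True True k := by
  simp only [numClassesDimSemi, orbitCountDim, semiRel_iff]

end OrbitRelations

section Asymptotics

variable (F : Type) [Field F] [Fintype F]

/-- The number of `k`-dimensional subspaces of `F ^ n`. -/
noncomputable def gaussCount (n k : ℕ) : ℕ :=
  Nat.card {W : Submodule F (Fin n → F) // Module.finrank F W = k}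

theorem gaussCount_eq {n k : ℕ} (hk : k ≤ n) : (gaussCount F n k : ℝ) =
    (Fintype.card F : ℝ) ^ (k * (n - k)) * (KqTrunc (Fintype.card F) n /
      (KqTrunc (Fintype.card F) k * KqTrunc (Fintype.card F) (n - k))) := by
  have h := card_subspaces_eq (F := F) (V := Fin n → F) (k := k) (by simpa using hk)
  simpa [gaussCount] using h

variable {F}

theorem summable_pow_natAbs_sq {w : ℝ} (h0 : 0 ≤ w) (h1 : w < 1) :
    Summable fun d : ℤ => w ^ (d.natAbs ^ 2) := by
  have h2 : Summable fun n : ℕ => w ^ (n ^ 2) :=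
    Summable.of_nonneg_of_le (fun _ => by positivity)
      (fun n => pow_le_pow_of_le_one h0 h1.le (Nat.le_self_pow two_ne_zero n))
      (summable_geometric_of_lt_one h0 h1)
  refine Summable.of_nat_of_neg ?_ ?_ <;> simpa using h2

theorem theta3_eq (w : ℝ) : theta3 w = ∑' d : ℤ, w ^ (d.natAbs ^ 2) := by
  refine tsum_congr fun d => ?_
  have h : ((d.natAbs ^ 2 : ℕ) : ℝ) = (d : ℝ) ^ 2 := by
    rw [Nat.cast_pow, Nat.cast_natAbs, Int.cast_abs, sq_abs]
  rw [← Real.rpow_natCast w, h]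

theorem theta3_pos {w : ℝ} (h0 : 0 ≤ w) (h1 : w < 1) : 0 < theta3 w := by
  rw [theta3_eq]
  refine (summable_pow_natAbs_sq h0 h1).tsum_pos (fun d => by positivity) 0 (by simp)

/-- `KqTrunc` quotient in the Gaussian binomial coefficient, tending to `1 / κ`. -/
theorem tendsto_KqTrunc_quotient {q : ℕ} {κ : ℝ} (hκ : 0 < κ)
    (h : Tendsto (KqTrunc q) atTop (𝓝 κ)) {u v w : ℕ → ℕ} (hu : Tendsto u atTop atTop)
    (hv : Tendsto v atTop atTop) (hw : Tendsto w atTop atTop) :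
    Tendsto (fun m => KqTrunc q (u m) / (KqTrunc q (v m) * KqTrunc q (w m))) atTop (𝓝 κ⁻¹) := by
  have := (h.comp hu).div ((h.comp hv).mul (h.comp hw)) (by positivity)
  rwa [div_mul_cancel_left₀ hκ.ne'] at this

theorem KqTrunc_quotient_le {q n k : ℕ} (hq : 2 ≤ q) (hk : k ≤ n) :
    KqTrunc q n / (KqTrunc q k * KqTrunc q (n - k)) ≤ 4 := by
  have h1 := KqTrunc_antitone hq hk
  have h2 := KqTrunc_ge hq (n - k)
  have h3 := KqTrunc_pos hq k
  rw [div_le_iff₀ (mul_pos h3 (by linarith))]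
  nlinarith

theorem tendsto_sum_gaussCount_div {κ : ℝ} (hκ : 0 < κ)
    (h : Tendsto (KqTrunc (Fintype.card F)) atTop (𝓝 κ)) :
    Tendsto (fun m : ℕ => (∑ k ∈ Finset.range (2 * m + 1), (gaussCount F (2 * m) k : ℝ)) /
      (Fintype.card F : ℝ) ^ (m * m)) atTop (𝓝 (theta3 (Fintype.card F : ℝ)⁻¹ * κ⁻¹)) := by
  have hq : 2 ≤ Fintype.card F := Fintype.one_lt_card
  set q := Fintype.card F with hqdef
  have hq0 : (0 : ℝ) < q := by positivity
  have hw0 : (0 : ℝ) ≤ (q : ℝ)⁻¹ := by positivity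
  have hw1 : (q : ℝ)⁻¹ < 1 := inv_lt_one_of_one_lt₀ (by exact_mod_cast hq)
  let r : ℕ → ℕ → ℝ := fun n k => KqTrunc q n / (KqTrunc q k * KqTrunc q (n - k))
  let g : ℕ → ℤ → ℝ := fun m d =>
    if d.natAbs ≤ m then (q : ℝ)⁻¹ ^ (d.natAbs ^ 2) * r (2 * m) (m + d).toNat else 0
  have hg : ∀ m, (∑ k ∈ Finset.range (2 * m + 1), (gaussCount F (2 * m) k : ℝ)) /
      (q : ℝ) ^ (m * m) = ∑' d, g m d := by
    intro m
    have hinj : Set.InjOn (fun k : ℕ => (k : ℤ) - m) (Finset.range (2 * m + 1)) := by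
      intro a _ b _ hab
      simpa using hab
    rw [tsum_eq_sum (s := (Finset.range (2 * m + 1)).image fun k : ℕ => (k : ℤ) - m),
      Finset.sum_image hinj, Finset.sum_div]
    · refine Finset.sum_congr rfl fun k hk => ?_
      rw [Finset.mem_range] at hk
      have h1 : ((k : ℤ) - m).natAbs ≤ m := by omega
      have h2 : ((m : ℤ) + ((k : ℤ) - m)).toNat = k := by omega
      have h3 : m * m = k * (2 * m - k) + ((k : ℤ) - m).natAbs ^ 2 := by
        zify [show k ≤ 2 * m by omega]
        rw [sq_abs]
        ring
      simp only [g, if_pos h1, h2]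
      rw [gaussCount_eq F (by omega), ← hqdef, h3, pow_add, inv_pow]
      simp only [r]
      field_simp
    · intro d hd
      simp only [g]
      rw [if_neg]
      contrapose! hd
      rw [Finset.mem_image]
      exact ⟨(m + d).toNat, by rw [Finset.mem_range]; omega, by omega⟩
  simp_rw [hg]
  rw [theta3_eq, ← tsum_mul_right]
  refine tendsto_tsum_of_dominated_convergence
    (bound := fun d : ℤ => (q : ℝ)⁻¹ ^ (d.natAbs ^ 2) * 4)
    ((summable_pow_natAbs_sq hw0 hw1).mul_right 4) (fun d => ?_) (Eventually.of_forall fun m d => ?_)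
  · have h1 : Tendsto (fun m : ℕ => (q : ℝ)⁻¹ ^ (d.natAbs ^ 2) * r (2 * m) (m + d).toNat) atTop
        (𝓝 ((q : ℝ)⁻¹ ^ (d.natAbs ^ 2) * κ⁻¹)) := by
      refine Tendsto.const_mul _ (tendsto_KqTrunc_quotient hκ h ?_ ?_ ?_)
      · exact tendsto_atTop_mono (fun m => by rw [id]; omega) tendsto_id
      · exact tendsto_atTop_mono (fun m => by omega) (tendsto_sub_atTop_nat d.natAbs)
      · exact tendsto_atTop_mono (fun m => by omega) (tendsto_sub_atTop_nat d.natAbs)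
    refine h1.congr' ?_
    filter_upwards [eventually_ge_atTop d.natAbs] with m hm
    simp only [g, if_pos hm]
  · simp only [g]
    split_ifs with hd
    · have hk : (m + d).toNat ≤ 2 * m := by omega
      have h1 := KqTrunc_quotient_le hq hk
      have h2 : 0 ≤ r (2 * m) (m + d).toNat := by
        have := KqTrunc_pos hq
        exact div_nonneg (this _).le (mul_nonneg (this _).le (this _).le)
      rw [Real.norm_of_nonneg (by positivity)]
      gcongr
    · rw [norm_zero]
      positivity

theorem tendsto_orbitError (F : Type) [Field F] [Fintype F] :
    Tendsto (fun m : ℕ => (Fintype.card F : ℝ) ^ (m / 192) * ((2 * m + 1) * orbitError F m) /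
      (Fintype.card F : ℝ) ^ (m * m)) atTop (𝓝 0) := by
  have hq : 2 ≤ Fintype.card F := Fintype.one_lt_card
  have hq1 : (1 : ℝ) < Fintype.card F := by exact_mod_cast hq
  set q : ℝ := (Fintype.card F : ℝ)
  have hq0 : 0 < q := by linarith
  set α : ℝ := (Nat.card (F ≃+* F) : ℝ)
  let u : ℕ → ℝ := fun m => 32 * q ^ 3 * m ^ 2 / q ^ (m / 96)
  let t : ℕ → ℝ := fun j => (j + 1) ^ 3 * q⁻¹ ^ j
  have ht : Tendsto (fun m : ℕ => t (m / 192)) atTop (𝓝 0) := by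
    have h1 : Tendsto t atTop (𝓝 0) := by
      have h2 := tendsto_pow_const_mul_const_pow_of_abs_lt_one 3 (r := q⁻¹)
        (by rw [abs_of_pos (by positivity)]; exact inv_lt_one_of_one_lt₀ hq1)
      have h3 := ((tendsto_add_atTop_iff_nat 1).2 h2).mul_const q
      rw [zero_mul] at h3
      refine h3.congr fun j => ?_
      simp only [t]
      rw [pow_succ q⁻¹]
      push_cast
      field_simp
    exact h1.comp (Nat.tendsto_div_const_atTop (by norm_num))
  have hu0 : ∀ m, 0 ≤ u m := fun m => by positivity
  have hm192 : ∀ m : ℕ, (m : ℝ) + 1 ≤ 192 * ((m / 192 : ℕ) + 1) := fun m => by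
    have : m + 1 ≤ 192 * (m / 192 + 1) := by omega
    exact_mod_cast this
  have hkey : ∀ m : ℕ, q ^ (m / 192) * (2 * m + 1) * u m ≤
      64 * q ^ 3 * 192 ^ 3 * t (m / 192) := by
    intro m
    have h1 : q ^ (m / 192) * q ^ (m / 192) ≤ q ^ (m / 96) := by
      rw [← pow_add]
      exact pow_le_pow_right₀ hq1.le (by omega)
    have h2 : q ^ (m / 192) / q ^ (m / 96) ≤ q⁻¹ ^ (m / 192) := by
      rw [inv_pow, div_le_iff₀ (by positivity), ← div_eq_inv_mul, le_div_iff₀ (by positivity)]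
      exact h1
    have h3 : (2 * (m : ℝ) + 1) * m ^ 2 ≤ 2 * (192 * ((m / 192 : ℕ) + 1)) ^ 3 := by
      calc (2 * (m : ℝ) + 1) * m ^ 2 ≤ (2 * ((m : ℝ) + 1)) * ((m : ℝ) + 1) ^ 2 := by gcongr <;> linarith
        _ = 2 * ((m : ℝ) + 1) ^ 3 := by ring
        _ ≤ _ := by gcongr; exact hm192 m
    calc q ^ (m / 192) * (2 * m + 1) * u m
        = 32 * q ^ 3 * (((2 * (m : ℝ) + 1) * m ^ 2) * (q ^ (m / 192) / q ^ (m / 96))) := by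
          simp only [u]; ring
      _ ≤ 32 * q ^ 3 * ((2 * (192 * ((m / 192 : ℕ) + 1)) ^ 3) * q⁻¹ ^ (m / 192)) := by gcongr
      _ = _ := by simp only [t]; ring
  have hsmall : ∀ᶠ m : ℕ in atTop, u m ≤ 1 := by
    have h1 := ht.const_mul (64 * q ^ 3 * 192 ^ 3)
    rw [mul_zero] at h1
    filter_upwards [h1.eventually (eventually_le_nhds one_pos)] with m hm
    refine le_trans ?_ ((hkey m).trans hm)
    refine le_mul_of_one_le_left (hu0 m) ?_
    have h2 : 1 ≤ q ^ (m / 192) := one_le_pow₀ hq1.le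
    have h3 : (1 : ℝ) ≤ 2 * m + 1 := by
      have : (0 : ℝ) ≤ m := by positivity
      linarith
    exact one_le_mul_of_one_le_of_one_le h2 h3
  have hlim := ht.const_mul (8 * q ^ 2 * α * q * 2 * (64 * q ^ 3 * 192 ^ 3))
  rw [mul_zero] at hlim
  refine squeeze_zero' (Eventually.of_forall fun m => ?_) ?_ hlim
  · have h1 : (1 : ℝ) ≤ (1 + (2 * m : ℕ) * q * (8 * q ^ 2 / q ^ (m / 96))) ^ (2 * m) :=
      one_le_pow₀ (le_add_of_nonneg_right (by positivity))
    have h2 : 0 ≤ orbitError F m := by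
      unfold orbitError
      have := sub_nonneg.2 h1
      positivity
    positivity
  · filter_upwards [hsmall] with m hm
    have h1 : (1 + (2 * m : ℕ) * q * (8 * q ^ 2 / q ^ (m / 96))) ^ (2 * m) - 1 ≤ 2 * u m := by
      have h2 : (1 + (2 * m : ℕ) * q * (8 * q ^ 2 / q ^ (m / 96))) ^ (2 * m) ≤ Real.exp (u m) := by
        calc _ ≤ Real.exp ((2 * m : ℕ) * q * (8 * q ^ 2 / q ^ (m / 96))) ^ (2 * m) := by
              gcongr
              rw [add_comm]
              exact Real.add_one_le_exp _
          _ = _ := by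
              rw [← Real.exp_nat_mul]
              congr 1
              simp only [u]
              push_cast
              ring
      have h3 := Real.abs_exp_sub_one_le (x := u m) (by rw [abs_of_nonneg (hu0 m)]; exact hm)
      rw [abs_of_nonneg (hu0 m)] at h3
      linarith [le_abs_self (Real.exp (u m) - 1)]
    calc q ^ (m / 192) * ((2 * m + 1) * orbitError F m) / q ^ (m * m)
        = 8 * q ^ 2 * α * q * (q ^ (m / 192) * (2 * m + 1)) *
          ((1 + (2 * m : ℕ) * q * (8 * q ^ 2 / q ^ (m / 96))) ^ (2 * m) - 1) := by
          unfold orbitError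
          rw [div_eq_iff (by positivity)]
          ring
      _ ≤ 8 * q ^ 2 * α * q * (q ^ (m / 192) * (2 * m + 1)) * (2 * u m) := by gcongr
      _ = 8 * q ^ 2 * α * q * 2 * (q ^ (m / 192) * (2 * m + 1) * u m) := by ring
      _ ≤ 8 * q ^ 2 * α * q * 2 * (64 * q ^ 3 * 192 ^ 3 * t (m / 192)) := by
          exact mul_le_mul_of_nonneg_left (hkey m) (by positivity)
      _ = _ := by ring

end Asymptotics

section OrbitRatio

theorem eventually_natAbs_sq_le_of_starCond {k : ℕ → ℕ}
    (h : StarCond 1 (1 / 384) k) :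
    ∀ᶠ m : ℕ in atTop, ((m : ℤ) - k (2 * m)).natAbs ^ 2 ≤ m / 192 := by
  have h2 : Tendsto (fun m : ℕ => 2 * m) atTop atTop :=
    tendsto_atTop_mono (fun m => by rw [id]; omega) tendsto_id
  filter_upwards [(h.comp h2).eventually (eventually_le_atBot 0)] with m hm
  simp only [Function.comp_apply] at hm
  push_cast at hm
  have hs := Real.sqrt_nonneg (2 * (m : ℝ))
  rw [Nat.le_div_iff_mul_le (by norm_num)]
  have h3 : ((m : ℝ) - k (2 * m)) ^ 2 * 192 ≤ m := by nlinarith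
  have h4 : ((m : ℤ) - k (2 * m)) ^ 2 * 192 ≤ m := by exact_mod_cast h3
  zify
  rwa [sq_abs]

theorem tendsto_orbitCountDim_div_orbitCount (F : Type) [Field F] [Fintype F] (d s : Prop)
    {k : ℕ → ℕ} (hk : ∀ n, k n ≤ n) (h : StarCond 1 (1 / 384) k) :
    Tendsto (fun m : ℕ =>
      ((orbitCountDim F (2 * m) d s (k (2 * m)) : ℝ) / (orbitCount F (2 * m) d s : ℝ)) /
        ((Fintype.card F : ℝ) ^ (-(((m : ℤ) - (k (2 * m) : ℤ)) ^ 2)) /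
          theta3 (Fintype.card F : ℝ)⁻¹)) atTop (𝓝 1) := by
  have hq : 2 ≤ Fintype.card F := Fintype.one_lt_card
  have hq1 : (1 : ℝ) < Fintype.card F := by exact_mod_cast hq
  obtain ⟨κ, hκ, hlim⟩ := exists_tendsto_KqTrunc hq
  have hsum := tendsto_sum_gaussCount_div hκ hlim
  have herr := tendsto_orbitError F
  have hθ : 0 < theta3 (Fintype.card F : ℝ)⁻¹ :=
    theta3_pos (by positivity) (inv_lt_one_of_one_lt₀ hq1)
  have hstar := eventually_natAbs_sq_le_of_starCond h
  have hc : ∀ m, ∃ c : ℝ, 0 < c ∧ (96 ≤ m → ∀ i ≤ 2 * m,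
      |c * orbitCountDim F (2 * m) d s i - gaussCount F (2 * m) i| ≤ orbitError F m) := by
    intro m
    by_cases hm : 96 ≤ m
    · obtain ⟨c, hc0, hc⟩ := exists_abs_mul_orbitCountDim_sub_le (F := F) hm d s
      exact ⟨c, hc0, fun _ => hc⟩
    · exact ⟨1, one_pos, fun h => absurd h hm⟩
  choose c hc0 hc using hc
  set q : ℝ := (Fintype.card F : ℝ)
  have hq0 : 0 < q := by linarith
  have hexp : ∀ m : ℕ, m * m =
      k (2 * m) * (2 * m - k (2 * m)) + ((m : ℤ) - k (2 * m)).natAbs ^ 2 := by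
    intro m
    zify [hk (2 * m)]
    rw [sq_abs]
    ring
  have hdim : Tendsto (fun m => c m * orbitCountDim F (2 * m) d s (k (2 * m)) /
      q ^ (k (2 * m) * (2 * m - k (2 * m)))) atTop (𝓝 κ⁻¹) := by
    have hnear : ∀ᶠ m : ℕ in atTop, m / 2 ≤ k (2 * m) ∧ m / 2 ≤ 2 * m - k (2 * m) := by
      filter_upwards [hstar] with m hm
      have h1 := Nat.le_self_pow two_ne_zero ((m : ℤ) - k (2 * m)).natAbs
      have h2 := hk (2 * m)
      omega
    have hhalf : Tendsto (fun m : ℕ => m / 2) atTop atTop :=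
      Nat.tendsto_div_const_atTop (by norm_num)
    have hgauss : Tendsto (fun m => (gaussCount F (2 * m) (k (2 * m)) : ℝ) /
        q ^ (k (2 * m) * (2 * m - k (2 * m)))) atTop (𝓝 κ⁻¹) := by
      refine (tendsto_KqTrunc_quotient hκ hlim (u := fun m => 2 * m)
        (v := fun m => k (2 * m)) (w := fun m => 2 * m - k (2 * m))
        (tendsto_atTop_mono (fun m => by rw [id]; omega) tendsto_id)
        (tendsto_atTop_mono' _ (hnear.mono fun m hm => hm.1) hhalf)
        (tendsto_atTop_mono' _ (hnear.mono fun m hm => hm.2) hhalf)).congr fun m => ?_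
      rw [gaussCount_eq F (hk (2 * m)), mul_div_cancel_left₀ _ (by positivity)]
    have hdiff : Tendsto (fun m => c m * orbitCountDim F (2 * m) d s (k (2 * m)) /
        q ^ (k (2 * m) * (2 * m - k (2 * m))) - (gaussCount F (2 * m) (k (2 * m)) : ℝ) /
        q ^ (k (2 * m) * (2 * m - k (2 * m)))) atTop (𝓝 0) := by
      refine squeeze_zero_norm' ?_ herr
      filter_upwards [hstar, eventually_ge_atTop 96] with m hm hm96
      have h1 := hc m hm96 _ (hk (2 * m))
      have h0 := (abs_nonneg _).trans h1
      rw [← sub_div, Real.norm_eq_abs, abs_div, abs_of_pos (pow_pos hq0 _),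
        div_le_div_iff₀ (by positivity) (by positivity), hexp m, pow_add]
      have h2 : q ^ (((m : ℤ) - k (2 * m)).natAbs ^ 2) ≤ q ^ (m / 192) :=
        pow_le_pow_right₀ hq1.le hm
      have h3 : orbitError F m ≤ (2 * m + 1) * orbitError F m :=
        le_mul_of_one_le_left h0 (by
          have : (0 : ℝ) ≤ m := by positivity
          linarith)
      calc _ ≤ ((2 * m + 1) * orbitError F m) * (q ^ (k (2 * m) * (2 * m - k (2 * m))) *
            q ^ (m / 192)) := by
            gcongr
            exact h1.trans h3
        _ = _ := by ring
    simpa using hdiff.add hgauss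
  have hall : Tendsto (fun m => c m * orbitCount F (2 * m) d s / q ^ (m * m)) atTop
      (𝓝 (theta3 q⁻¹ * κ⁻¹)) := by
    have hdiff : Tendsto (fun m => c m * orbitCount F (2 * m) d s / q ^ (m * m) -
        (∑ i ∈ Finset.range (2 * m + 1), (gaussCount F (2 * m) i : ℝ)) / q ^ (m * m))
        atTop (𝓝 0) := by
      refine squeeze_zero_norm' ?_ herr
      filter_upwards [eventually_ge_atTop 96] with m hm96
      have h0 := (abs_nonneg _).trans (hc m hm96 0 (by omega))
      rw [← sub_div, Real.norm_eq_abs, abs_div, abs_of_pos (pow_pos hq0 _)]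
      gcongr
      rw [orbitCount_eq_sum, Nat.cast_sum, Finset.mul_sum, ← Finset.sum_sub_distrib]
      calc _ ≤ ∑ i ∈ Finset.range (2 * m + 1),
            |c m * orbitCountDim F (2 * m) d s i - gaussCount F (2 * m) i| :=
            Finset.abs_sum_le_sum_abs _ _
        _ ≤ ∑ i ∈ Finset.range (2 * m + 1), orbitError F m :=
            Finset.sum_le_sum fun i hi => hc m hm96 i (by rw [Finset.mem_range] at hi; omega)
        _ = (2 * m + 1) * orbitError F m := by simp
        _ ≤ _ := le_mul_of_one_le_left (by positivity) (one_le_pow₀ hq1.le)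
    simpa using hdiff.add hsum
  have hratio := (hdim.div hall (by positivity)).mul_const (theta3 q⁻¹)
  have hval : κ⁻¹ / (theta3 q⁻¹ * κ⁻¹) * theta3 q⁻¹ = 1 := by
    generalize theta3 q⁻¹ = θ at hθ ⊢
    field_simp
  rw [hval] at hratio
  refine hratio.congr fun m => ?_
  have hz : q ^ (-(((m : ℤ) - (k (2 * m) : ℤ)) ^ 2)) =
      (q ^ (((m : ℤ) - k (2 * m)).natAbs ^ 2))⁻¹ := by
    rw [_root_.zpow_neg, ← zpow_natCast]
    congr 2
    push_cast
    rw [sq_abs]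
  have hcm := (hc0 m).ne'
  rw [hz, Pi.div_apply, hexp m, pow_add]
  by_cases hN : (orbitCount F (2 * m) d s : ℝ) = 0
  · simp [hN]
  · field_simp

end OrbitRatio

theorem stmt16 (q p h : ℕ) (hp : p.Prime) (hh : 1 ≤ h) (hqph : q = p ^ h)
    (F : Type) [Field F] [Fintype F] (hq : Fintype.card F = q) :
    ∃ A > (0 : ℝ), ∃ ε > (0 : ℝ), ∀ k : ℕ → ℕ, (∀ n, k n ≤ n) → StarCond A ε k →
      (Tendsto (fun m : ℕ =>
          ((numClassesDim F (PermGroup F (2 * m)) (k (2 * m)) : ℝ) /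
            (numClasses F (PermGroup F (2 * m)) : ℝ)) /
          ((q : ℝ) ^ (-(((m : ℤ) - (k (2 * m) : ℤ)) ^ 2)) / theta3 ((q : ℝ))⁻¹))
        atTop (𝓝 1)) ∧
      (Tendsto (fun m : ℕ =>
          ((numClassesDim F (MonomialGroup F (2 * m)) (k (2 * m)) : ℝ) /
            (numClasses F (MonomialGroup F (2 * m)) : ℝ)) /
          ((q : ℝ) ^ (-(((m : ℤ) - (k (2 * m) : ℤ)) ^ 2)) / theta3 ((q : ℝ))⁻¹))
        atTop (𝓝 1)) ∧
      (Tendsto (fun m : ℕ =>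
          ((numClassesDimSemi F (2 * m) (k (2 * m)) : ℝ) /
            (numClassesSemi F (2 * m) : ℝ)) /
          ((q : ℝ) ^ (-(((m : ℤ) - (k (2 * m) : ℤ)) ^ 2)) / theta3 ((q : ℝ))⁻¹))
        atTop (𝓝 1)) := by
  subst hq
  refine ⟨1, one_pos, 1 / 384, by norm_num, fun k hk hstar => ⟨?_, ?_, ?_⟩⟩
  · simp only [numClassesDim_permGroup, numClasses_permGroup]
    exact tendsto_orbitCountDim_div_orbitCount F False False hk hstar
  · simp only [numClassesDim_monomialGroup, numClasses_monomialGroup]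
    exact tendsto_orbitCountDim_div_orbitCount F True False hk hstar
  · simp only [numClassesDimSemi_eq, numClassesSemi_eq]
    exact tendsto_orbitCountDim_div_orbitCount F True True hk hstar
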